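/- arXiv:1212.1023 — 4 statements merged into one kernel-verified Lean document; each statement's English description precedes it below -/
import Mathlib

section
/- The field of U-invariant rational functions K(M)^U of the adjoint representation of GL(n,K) equals the subfield of K(M) generated over K by the n(n+1)/2 polynomials J_{k,i}, 1 ≤ k ≤ n, 0 ≤ i ≤ k−1. -/
open Matrix MvPolynomial

/-- `u` is an upper triangular matrix with all diagonal entries equal to `1`
(upper unitriangular matrix). -/
def IsUniUpperTriangular {n : ℕ} {K : Type*} [CommRing K]
    (u : Matrix (Fin n) (Fin n) K) : Prop :=
  (∀ a : Fin n, u a a = 1) ∧ ∀ a b : Fin n, (b : ℕ) < (a : ℕ) → u a b = 0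

/-- The polynomial invariant `J_{k,i}` evaluated at a matrix `A`: the
determinant of the `k × k` matrix whose first `k - i` rows are the last
`k - i` rows of `A` restricted to the first `k` columns, and whose last `i`
rows are the last `i` rows of the adjugate matrix `A*` restricted to the first
`k` columns. -/
def Jki {n : ℕ} {R : Type*} [CommRing R] (k i : ℕ) (hk : k ≤ n) (hik : i < k)
    (A : Matrix (Fin n) (Fin n) R) : R :=
  Matrix.det (Matrix.of fun r c : Fin k =>
    if h : (r : ℕ) < k - i then
      A ⟨n - (k - i) + (r : ℕ), by have := r.isLt; omega⟩
        ⟨(c : ℕ), by have := c.isLt; omega⟩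
    else
      A.adjugate ⟨n - i + ((r : ℕ) - (k - i)), by have := r.isLt; omega⟩
        ⟨(c : ℕ), by have := c.isLt; omega⟩)

/-- The generic matrix `X = (x_{ab})` over the polynomial ring `K[x]` in the
`n²` matrix entries. -/
noncomputable def genMatrix (K : Type*) [CommRing K] (n : ℕ) :
    Matrix (Fin n) (Fin n) (MvPolynomial (Fin n × Fin n) K) :=
  Matrix.of fun a b => MvPolynomial.X (a, b)

/-- The `K`-algebra endomorphism `ρ_u` of `K[x] = K[x_{ab}]` sending each
`x_{ab}` to the `(a,b)` entry of `u⁻¹ X u`, where `X` is the generic matrix. -/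
noncomputable def rho {n : ℕ} {K : Type*} [Field K]
    (u : Matrix (Fin n) (Fin n) K) :
    MvPolynomial (Fin n × Fin n) K →ₐ[K] MvPolynomial (Fin n × Fin n) K :=
  MvPolynomial.aeval fun ab =>
    (((u⁻¹).map MvPolynomial.C * genMatrix K n * u.map MvPolynomial.C :
      Matrix (Fin n) (Fin n) (MvPolynomial (Fin n × Fin n) K)) ab.1 ab.2)


/-! ### Determinant helpers -/

theorem Uinv_det_submatrix_sign {R : Type*} [CommRing R] {m p : Type*} [Fintype m] [DecidableEq m]
    [Fintype p] [DecidableEq p] (e₁ e₂ : p ≃ m) (A : Matrix m m R) :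
    ∃ ε : R, (ε = 1 ∨ ε = -1) ∧ A.det = ε * (A.submatrix e₁ e₂).det := by
  have h : (A.submatrix e₁ e₂) = (A.submatrix e₂ e₂).submatrix (e₁.trans e₂.symm) id := by
    ext a b; simp
  rw [h, Matrix.det_permute, Matrix.det_submatrix_equiv_self]
  rcases Int.units_eq_one_or (Equiv.Perm.sign (e₁.trans e₂.symm)) with h | h
  · exact ⟨1, Or.inl rfl, by simp [h]⟩
  · exact ⟨-1, Or.inr rfl, by simp [h]⟩

theorem Uinv_mul_submatrix_left {R : Type*} [CommRing R] {p q s t : Type*} [Fintype p]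
    [Fintype s] [DecidableEq p] (ι : s → p) (hι : Function.Injective ι) (κ : t → q)
    (V : Matrix p p R) (Y : Matrix p q R)
    (hV : ∀ r a, a ∉ Set.range ι → V (ι r) a = 0) :
    (V * Y).submatrix ι κ = V.submatrix ι ι * Y.submatrix ι κ := by
  ext r c
  simp only [Matrix.submatrix_apply, Matrix.mul_apply]
  symm
  apply Fintype.sum_of_injective ι hι
  · intro a ha; rw [hV r a ha, zero_mul]
  · intro j; rfl

theorem Uinv_mul_submatrix_right {R : Type*} [CommRing R] {p q s t : Type*} [Fintype q]
    [Fintype t] [DecidableEq q] (ι : s → p) (κ : t → q) (hκ : Function.Injective κ)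
    (V : Matrix q q R) (Y : Matrix p q R)
    (hV : ∀ r a, a ∉ Set.range κ → V a (κ r) = 0) :
    (Y * V).submatrix ι κ = Y.submatrix ι κ * V.submatrix κ κ := by
  ext r c
  simp only [Matrix.submatrix_apply, Matrix.mul_apply]
  symm
  apply Fintype.sum_of_injective κ hκ
  · intro a ha; rw [hV c a ha, mul_zero]
  · intro j; rfl

theorem IsUniUpperTriangular.det_one' {n : ℕ} {R : Type*} [CommRing R]
    {u : Matrix (Fin n) (Fin n) R} (hu : IsUniUpperTriangular u) : u.det = 1 := by
  rw [Matrix.det_of_isUpperTriangular]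
  · simp [hu.1]
  · intro a b hab; exact hu.2 a b hab

theorem IsUniUpperTriangular.inv' {n : ℕ} {R : Type*} [Field R]
    {u : Matrix (Fin n) (Fin n) R} (hu : IsUniUpperTriangular u) : IsUniUpperTriangular u⁻¹ := by
  have hdet : IsUnit u.det := by rw [hu.det_one']; exact isUnit_one
  have hU : u.BlockTriangular id := fun a b hab => hu.2 a b hab
  have : Invertible u := Matrix.invertibleOfIsUnitDet u hdet
  have hI : u⁻¹.BlockTriangular id := Matrix.blockTriangular_inv_of_blockTriangular hU
  refine ⟨fun a => ?_, fun a b hab => hI hab⟩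
  have h1 : (u⁻¹ * u) a a = 1 := by rw [Matrix.nonsing_inv_mul u hdet]; simp
  rw [Matrix.mul_apply, Finset.sum_eq_single a] at h1
  · rwa [hu.1, mul_one] at h1
  · intro b _ hb
    rcases lt_or_gt_of_ne hb with h | h
    · rw [hI h, zero_mul]
    · rw [hu.2 b a h, mul_zero]
  · simp

/-! ### The row selection of `Jki` -/

/-- Row selection for `Jki` in the stacked matrix. -/
def uRow {n : ℕ} (k i : ℕ) (hk : k ≤ n) (hik : i < k) (r : Fin k) : Fin n ⊕ Fin n :=
  if h : (r : ℕ) < k - i then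
    Sum.inl ⟨n - (k - i) + (r : ℕ), by have := r.isLt; omega⟩
  else Sum.inr ⟨n - i + ((r : ℕ) - (k - i)), by have := r.isLt; omega⟩

theorem uRow_injective {n : ℕ} (k i : ℕ) (hk : k ≤ n) (hik : i < k) :
    Function.Injective (uRow (n := n) k i hk hik) := by
  intro r s h
  unfold uRow at h
  have := r.isLt
  have := s.isLt
  apply Fin.ext
  split_ifs at h <;> simp at h <;> omega

theorem Jki_eq_det {n : ℕ} {R : Type*} [CommRing R] (k i : ℕ) (hk : k ≤ n) (hik : i < k)
    (A : Matrix (Fin n) (Fin n) R) :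
    Jki k i hk hik A =
      ((Matrix.fromRows A A.adjugate).submatrix (uRow k i hk hik) (Fin.castLE hk)).det := by
  unfold Jki
  congr 1
  ext r c
  simp only [Matrix.of_apply, Matrix.submatrix_apply, uRow]
  split_ifs <;> rfl

theorem Jki_map {n : ℕ} {R S : Type*} [CommRing R] [CommRing S] (k i : ℕ) (hk : k ≤ n)
    (hik : i < k) (f : R →+* S) (A : Matrix (Fin n) (Fin n) R) :
    f (Jki k i hk hik A) = Jki k i hk hik (A.map f) := by
  have h : (A.map f).adjugate = A.adjugate.map f := by
    have := f.map_adjugate A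
    simpa using this.symm
  unfold Jki
  rw [RingHom.map_det, h]
  congr 1
  ext r c
  simp only [RingHom.mapMatrix_apply, Matrix.map_apply, Matrix.of_apply]
  split_ifs <;> rfl

theorem Jki_conj {n : ℕ} {R : Type*} [CommRing R] (k i : ℕ) (hk : k ≤ n) (hik : i < k)
    (A h g : Matrix (Fin n) (Fin n) R) (hh : IsUniUpperTriangular h)
    (hg : IsUniUpperTriangular g) (hhg : h * g = 1) :
    Jki k i hk hik (h * A * g) = Jki k i hk hik A := by
  have hgh : g * h = 1 := mul_eq_one_comm.mp hhg
  have adg : g.adjugate = h := by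
    have : g.adjugate * g * h = h := by rw [Matrix.adjugate_mul, hg.det_one', one_smul, one_mul]
    rwa [mul_assoc, hgh, mul_one] at this
  have adh : h.adjugate = g := by
    have : h.adjugate * h * g = g := by rw [Matrix.adjugate_mul, hh.det_one', one_smul, one_mul]
    rwa [mul_assoc, hhg, mul_one] at this
  have had : (h * A * g).adjugate = h * A.adjugate * g := by
    rw [Matrix.adjugate_mul_distrib, Matrix.adjugate_mul_distrib, adg, adh, mul_assoc]
  have hst : Matrix.fromRows (h * A * g) (h * A.adjugate * g) =
      Matrix.fromBlocks h 0 0 h * (Matrix.fromRows A A.adjugate * g) := by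
    rw [Matrix.fromRows_mul, Matrix.fromBlocks_mul_fromRows]
    simp [mul_assoc]
  rw [Jki_eq_det, Jki_eq_det, had, hst,
    Uinv_mul_submatrix_left (uRow k i hk hik) (uRow_injective k i hk hik) (Fin.castLE hk),
    Uinv_mul_submatrix_right _ (Fin.castLE hk) (Fin.castLE_injective hk), Matrix.det_mul,
    Matrix.det_mul]
  · have d1 : ((Matrix.fromBlocks h 0 0 h).submatrix (uRow k i hk hik) (uRow k i hk hik)).det
        = 1 := by
      rw [Matrix.det_of_isUpperTriangular]
      · apply Finset.prod_eq_one
        intro r _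
        simp only [Matrix.submatrix_apply, uRow]
        split_ifs <;> simp [hh.1]
      · intro r s hrs
        have hrs' : (s : ℕ) < r := hrs
        simp only [Matrix.submatrix_apply, uRow]
        split_ifs
        · exact hh.2 _ _ (by simp; omega)
        · rfl
        · rfl
        · exact hh.2 _ _ (by simp; omega)
    have d2 : (g.submatrix (Fin.castLE hk) (Fin.castLE hk)).det = 1 := by
      rw [Matrix.det_of_isUpperTriangular]
      · apply Finset.prod_eq_one
        intro r _
        simp [hg.1]
      · intro r s hrs
        exact hg.2 _ _ hrs
    rw [d1, d2, one_mul, mul_one]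
  · intro r a ha
    apply hg.2
    by_contra hlt
    exact ha ⟨⟨a, by have := r.isLt; simp at hlt; omega⟩, rfl⟩
  · intro r a ha
    have hr := r.isLt
    by_cases hri : (r : ℕ) < k - i
    · rcases a with a | a
      · simp only [uRow, hri, dif_pos, Matrix.fromBlocks_apply₁₁]
        apply hh.2
        by_contra hlt
        simp at hlt
        have ha' := a.isLt
        apply ha
        refine ⟨⟨(a : ℕ) - (n - (k - i)), by omega⟩, ?_⟩
        have : (a : ℕ) - (n - (k - i)) < k - i := by omega
        simp only [uRow, this, dif_pos]
        congr 1
        apply Fin.ext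
        simp
        omega
      · simp [uRow, hri]
    · rcases a with a | a
      · simp [uRow, hri]
      · simp only [uRow, hri, dif_neg, not_false_eq_true, Matrix.fromBlocks_apply₂₂]
        apply hh.2
        by_contra hlt
        simp at hlt
        have ha' := a.isLt
        apply ha
        refine ⟨⟨(a : ℕ) - (n - i) + (k - i), by omega⟩, ?_⟩
        have : ¬ ((a : ℕ) - (n - i) + (k - i) < k - i) := by omega
        simp only [uRow, this, dif_neg, not_false_eq_true]
        congr 1
        apply Fin.ext
        simp
        omega

/-! ### Antitriangular matrices -/

/-- The solid minor of the first `m` rows with columns starting at `i`. -/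
def uMinor {n : ℕ} {R : Type*} [CommRing R] (C : Matrix (Fin n) (Fin n) R) (m i : ℕ)
    (h : i + m ≤ n) : R :=
  (C.submatrix (fun r : Fin m => (⟨r, by have := r.isLt; omega⟩ : Fin n))
    (fun c : Fin m => (⟨i + c, by have := c.isLt; omega⟩ : Fin n))).det

theorem Jki_anti {n : ℕ} {L : Type*} [Field L] (B : Matrix (Fin n) (Fin n) L)
    (hB : (B.submatrix Fin.revPerm id).BlockTriangular id) (hd : B.det ≠ 0)
    (k i : ℕ) (hk : k ≤ n) (hik : i < k) :
    ∃ ε : L, (ε = 1 ∨ ε = -1) ∧ Jki k i hk hik B =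
      ε * (uMinor (B.submatrix Fin.revPerm id) (k - i) i (by omega) *
        ∏ r : Fin i, (B.det * (B.submatrix Fin.revPerm id)⁻¹
          ⟨n - i + r, by have := r.isLt; omega⟩ ⟨n - i + r, by have := r.isLt; omega⟩)) := by
  set C := B.submatrix Fin.revPerm id with hC
  have hCd : IsUnit C.det := by
    have : C.det = Equiv.Perm.sign (Fin.revPerm : Equiv.Perm (Fin n)) * B.det :=
      Matrix.det_permute _ _
    rw [this]
    apply IsUnit.mul
    · exact (Units.isUnit (Equiv.Perm.sign (Fin.revPerm : Equiv.Perm (Fin n)))).map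
        (Int.castRingHom L)
    · exact hd.isUnit
  have : Invertible C := Matrix.invertibleOfIsUnitDet C hCd
  have hI : C⁻¹.BlockTriangular id := Matrix.blockTriangular_inv_of_blockTriangular hB
  have hadj : ∀ a b, B.adjugate a b = B.det * C⁻¹ a (Fin.rev b) := by
    intro a b
    have h1 : C⁻¹ = B⁻¹.submatrix id Fin.revPerm :=
      Matrix.inv_submatrix_equiv B Fin.revPerm (Equiv.refl _)
    rw [h1, Matrix.inv_def]
    simp [hd]
  let e₁ : Fin (k - i) ⊕ Fin i ≃ Fin k :=
    ((Equiv.sumCongr Fin.revPerm (Equiv.refl _)).trans finSumFinEquiv).trans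
      (finCongr (by omega))
  let e₂ : Fin (k - i) ⊕ Fin i ≃ Fin k :=
    (((Equiv.sumCongr (Equiv.refl _) Fin.revPerm).trans (Equiv.sumComm _ _)).trans
      finSumFinEquiv).trans (finCongr (by omega))
  have e1l : ∀ r, ((e₁ (Sum.inl r) : Fin k) : ℕ) = k - i - 1 - r := by
    intro r; simp [e₁]; omega
  have e1r : ∀ r, ((e₁ (Sum.inr r) : Fin k) : ℕ) = k - i + r := by
    intro r; simp [e₁]
  have e2l : ∀ r, ((e₂ (Sum.inl r) : Fin k) : ℕ) = i + r := by
    intro r; simp [e₂]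
  have e2r : ∀ r, ((e₂ (Sum.inr r) : Fin k) : ℕ) = i - 1 - r := by
    intro r; simp [e₂]; omega
  obtain ⟨ε, hε, h⟩ := Uinv_det_submatrix_sign e₁ e₂
    ((Matrix.fromRows B B.adjugate).submatrix (uRow k i hk hik) (Fin.castLE hk))
  refine ⟨ε, hε, ?_⟩
  rw [Jki_eq_det, h]
  congr 1
  set Rm : Matrix (Fin i) (Fin i) L := Matrix.of fun r c =>
    B.det * C⁻¹ ⟨n - i + r, by have := r.isLt; omega⟩ ⟨n - i + c, by have := c.isLt; omega⟩
    with hRm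
  have hR : Rm.det = ∏ r : Fin i, (B.det * C⁻¹
          ⟨n - i + r, by have := r.isLt; omega⟩ ⟨n - i + r, by have := r.isLt; omega⟩) := by
    rw [Matrix.det_of_isUpperTriangular]
    · rfl
    · intro r c hrc
      have hrc' : (c : ℕ) < r := hrc
      simp only [hRm, Matrix.of_apply]
      rw [hI, mul_zero]
      simp only [id, Fin.lt_def]
      omega
  rw [← hR, uMinor]
  rw [← Matrix.det_fromBlocks_zero₂₁ _ (Matrix.of fun (r : Fin (k - i)) (c : Fin i) =>
    (Matrix.fromRows B B.adjugate) (uRow k i hk hik (e₁ (Sum.inl r)))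
      (Fin.castLE hk (e₂ (Sum.inr c)))) Rm]
  congr 1
  ext r c
  rcases r with r | r
  · have hr := r.isLt
    have h1 : uRow (n := n) k i hk hik (e₁ (Sum.inl r)) = Sum.inl (Fin.rev ⟨r, by omega⟩) := by
      have : ((e₁ (Sum.inl r) : Fin k) : ℕ) < k - i := by rw [e1l]; omega
      simp only [uRow, this, dif_pos]
      congr 1
      apply Fin.ext
      simp [e1l]
      omega
    rcases c with c | c
    · simp only [Matrix.submatrix_apply, h1, Matrix.fromBlocks_apply₁₁, Matrix.fromRows_apply_inl,
        hC, Fin.revPerm_apply, id]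
      congr 1
    · simp [Matrix.submatrix_apply]
  · have hr := r.isLt
    have h1 : uRow (n := n) k i hk hik (e₁ (Sum.inr r)) = Sum.inr ⟨n - i + r, by omega⟩ := by
      have : ¬ ((e₁ (Sum.inr r) : Fin k) : ℕ) < k - i := by rw [e1r]; omega
      simp only [uRow, this, dif_neg, not_false_eq_true]
      congr 1
      apply Fin.ext
      simp [e1r]
    rcases c with c | c
    · have hc := c.isLt
      simp only [Matrix.submatrix_apply, h1, Matrix.fromBlocks_apply₂₁, Matrix.fromRows_apply_inr,
        hadj, Matrix.zero_apply]
      rw [hI, mul_zero]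
      simp only [id, Fin.lt_def, Fin.val_rev, Fin.val_castLE, e2l]
      omega
    · have hc := c.isLt
      simp only [Matrix.submatrix_apply, h1, Matrix.fromBlocks_apply₂₂, Matrix.fromRows_apply_inr,
        hadj, hRm, Matrix.of_apply]
      congr 2
      refine congrArg _ (Fin.ext ?_)
      simp only [Fin.val_rev, Fin.val_castLE, e2r]
      omega

theorem Uinv_det_mem {L : Type*} [Field L] (F : Subfield L) {m : Type*} [Fintype m]
    [DecidableEq m] (A : Matrix m m L) (h : ∀ a b, A a b ∈ F) : A.det ∈ F := by
  rw [Matrix.det_apply]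
  refine sum_mem fun σ _ => ?_
  rw [Units.smul_def]
  exact zsmul_mem (prod_mem fun i _ => h _ _) _

theorem Uinv_entries_mem {n : ℕ} {L : Type*} [Field L] (F : Subfield L)
    (C : Matrix (Fin n) (Fin n) L) (hC : C.BlockTriangular id)
    (hm : ∀ m i (h : i + m ≤ n), uMinor C m i h ∈ F)
    (h0 : ∀ m i (h : i + m ≤ n), uMinor C m i h ≠ 0) :
    ∀ (a b : ℕ) (ha : a < n) (hb : b < n), C ⟨a, ha⟩ ⟨b, hb⟩ ∈ F := by
  intro a
  induction a using Nat.strong_induction_on with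
  | _ a iha =>
  intro b
  induction b using Nat.strong_induction_on with
  | _ b ihb =>
  intro ha hb
  by_cases hba : b < a
  · rw [hC (show (⟨b, hb⟩ : Fin n) < ⟨a, ha⟩ from hba)]
    exact zero_mem _
  · obtain ⟨i, rfl⟩ : ∃ i, b = i + a := ⟨b - a, by omega⟩
    have hmem := hm (a + 1) i (by omega)
    rw [uMinor, Matrix.det_succ_row _ (Fin.last a), Fin.sum_univ_castSucc] at hmem
    have hs := (add_mem_cancel_left ?_).1 hmem
    · have hl : (Fin.last a).succAbove = Fin.castSucc := by ext; simp
      simp only [Matrix.submatrix_apply, Matrix.submatrix_submatrix, hl] at hs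
      have hne := h0 a i (by omega)
      have hme := hm a i (by omega)
      have hs' : (-1 : L) ^ (a + a) * C ⟨a, ha⟩ ⟨i + a, hb⟩ * uMinor C a i (by omega) ∈ F := hs
      have h1 : (-1 : L) ^ (a + a) = 1 := Even.neg_one_pow ⟨a, rfl⟩
      rw [h1, one_mul] at hs'
      have := div_mem hs' hme
      rwa [mul_div_cancel_right₀ _ hne] at this
    · refine sum_mem fun j _ => ?_
      have hj := j.isLt
      refine mul_mem (mul_mem (pow_mem (neg_mem (one_mem _)) _) ?_) ?_
      · exact ihb (i + j) (by omega) ha (by omega)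
      · apply Uinv_det_mem
        intro r c
        simp only [Matrix.submatrix_apply]
        refine iha _ ?_ _ _ _
        have := r.isLt
        simp

theorem Uinv_sign_mul_mem {L : Type*} [Field L] (F : Subfield L) {ε x : L}
    (hε : ε = 1 ∨ ε = -1) (h : ε * x ∈ F) : x ∈ F := by
  rcases hε with rfl | rfl
  · simpa using h
  · simpa using h

theorem Uinv_diag_inv {n : ℕ} {L : Type*} [Field L] (C : Matrix (Fin n) (Fin n) L)
    (hC : C.BlockTriangular id) (hd : IsUnit C.det) (a : Fin n) : C⁻¹ a a * C a a = 1 := by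
  have : Invertible C := Matrix.invertibleOfIsUnitDet C hd
  have hI : C⁻¹.BlockTriangular id := Matrix.blockTriangular_inv_of_blockTriangular hC
  have h1 : (C⁻¹ * C) a a = 1 := by rw [Matrix.nonsing_inv_mul C hd]; simp
  rw [Matrix.mul_apply, Finset.sum_eq_single a] at h1
  · exact h1
  · intro b _ hb
    rcases lt_or_gt_of_ne hb with h | h
    · rw [hI h, zero_mul]
    · rw [hC h, mul_zero]
  · simp

theorem Uinv_rev_det_isUnit {n : ℕ} {L : Type*} [Field L] (B : Matrix (Fin n) (Fin n) L)
    (hd : B.det ≠ 0) : IsUnit (B.submatrix Fin.revPerm id).det := by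
  rw [Matrix.det_permute]
  apply IsUnit.mul
  · exact (Units.isUnit (Equiv.Perm.sign (Fin.revPerm : Equiv.Perm (Fin n)))).map
      (Int.castRingHom L)
  · exact hd.isUnit

theorem Uinv_anti_mem {n : ℕ} {L : Type*} [Field L] (F : Subfield L)
    (B : Matrix (Fin n) (Fin n) L)
    (hB : (B.submatrix Fin.revPerm id).BlockTriangular id) (hd : B.det ≠ 0) (hdF : B.det ∈ F)
    (hJ : ∀ k i (hk : k ≤ n) (hik : i < k), Jki k i hk hik B ∈ F)
    (hJ0 : ∀ k i (hk : k ≤ n) (hik : i < k), Jki k i hk hik B ≠ 0) :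
    ∀ a b, B a b ∈ F := by
  set C := B.submatrix Fin.revPerm id with hC
  have h0 : ∀ m i (h : i + m ≤ n), uMinor C m i h ≠ 0 := by
    intro m i h
    rcases Nat.eq_zero_or_pos m with rfl | hm
    · simp [uMinor]
    obtain ⟨ε, hε, hj⟩ := Jki_anti B hB hd (i + m) i h (by omega)
    have := hJ0 (i + m) i h (by omega)
    rw [hj] at this
    have h2 := left_ne_zero_of_mul (right_ne_zero_of_mul this)
    convert h2 using 2
    omega
  have hm0 : ∀ m (h : 0 + m ≤ n), uMinor C m 0 h ∈ F := by
    intro m h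
    rcases Nat.eq_zero_or_pos m with rfl | hm
    · simp [uMinor]
    obtain ⟨ε, hε, hj⟩ := Jki_anti B hB hd m 0 (by omega) (by omega)
    have := hJ m 0 (by omega) (by omega)
    rw [hj] at this
    simpa using Uinv_sign_mul_mem F hε this
  have hdiag : ∀ a : Fin n, C a a ∈ F := by
    have hp : ∀ m (h : 0 + m ≤ n), uMinor C m 0 h =
        ∏ r : Fin m, C ⟨r, by have := r.isLt; omega⟩ ⟨r, by have := r.isLt; omega⟩ := by
      intro m h
      rw [uMinor, Matrix.det_of_isUpperTriangular]
      · exact Finset.prod_congr rfl fun r _ => by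
          rw [Matrix.submatrix_apply]
          exact congrArg (C _) (Fin.ext (Nat.zero_add _))
      · intro r c hrc
        have hrc' : (c : ℕ) < r := hrc
        apply hB
        show 0 + (c : ℕ) < r
        omega
    intro a
    have ha := a.isLt
    have h1 := hm0 (a + 1) (by omega)
    have h2 := hm0 a (by omega)
    have h3 := h0 a 0 (by omega)
    have h4 : uMinor C (a + 1) 0 (by omega) = uMinor C a 0 (by omega) * C a a := by
      rw [hp, hp, Fin.prod_univ_castSucc]
      rfl
    have h5 := div_mem h1 h2
    rwa [h4, mul_div_cancel_left₀ _ h3] at h5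
  have hinv : ∀ a, C⁻¹ a a ∈ F ∧ C⁻¹ a a ≠ 0 := by
    intro a
    have := Uinv_diag_inv C hB (Uinv_rev_det_isUnit B hd) a
    rw [eq_inv_of_mul_eq_one_left this]
    exact ⟨inv_mem (hdiag a), inv_ne_zero (right_ne_zero_of_mul (this.trans_ne one_ne_zero))⟩
  have hm : ∀ m i (h : i + m ≤ n), uMinor C m i h ∈ F := by
    intro m i h
    rcases Nat.eq_zero_or_pos m with rfl | hm
    · simp [uMinor]
    obtain ⟨ε, hε, hj⟩ := Jki_anti B hB hd (i + m) i h (by omega)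
    have h1 := hJ (i + m) i h (by omega)
    rw [hj] at h1
    have h2 := Uinv_sign_mul_mem F hε h1
    have hprod : ∏ r : Fin i, (B.det * C⁻¹
        ⟨n - i + r, by have := r.isLt; omega⟩ ⟨n - i + r, by have := r.isLt; omega⟩) ∈ F :=
      prod_mem fun r _ => mul_mem hdF (hinv _).1
    have hprod0 : ∏ r : Fin i, (B.det * C⁻¹
        ⟨n - i + r, by have := r.isLt; omega⟩ ⟨n - i + r, by have := r.isLt; omega⟩) ≠ 0 :=
      Finset.prod_ne_zero_iff.mpr fun r _ => mul_ne_zero hd (hinv _).2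
    have h3 := div_mem h2 hprod
    rw [mul_div_cancel_right₀ _ hprod0] at h3
    convert h3 using 2
    omega
  intro a b
  have := Uinv_entries_mem F C hB hm h0 (Fin.rev a) b (Fin.isLt _) (Fin.isLt _)
  have h2 : C (Fin.rev a) b ∈ F := this
  rwa [hC, Matrix.submatrix_apply, Fin.revPerm_apply, Fin.rev_rev] at h2

/-- A test matrix at which `Jki` does not vanish. -/
def uTest (n : ℕ) (K : Type*) [CommRing K] (i : ℕ) : Matrix (Fin n) (Fin n) K :=
  Matrix.of fun a b =>
    if (b : ℕ) = (Fin.rev a : Fin n) ∨ (b : ℕ) = (Fin.rev a : Fin n) + i then 1 else 0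

theorem Jki_uTest_ne_zero {n : ℕ} {K : Type*} [Field K] (k i : ℕ) (hk : k ≤ n) (hik : i < k) :
    Jki k i hk hik (uTest n K i) ≠ 0 := by
  have hCe : ∀ a b, (uTest n K i).submatrix Fin.revPerm id a b =
      if (b : ℕ) = a ∨ (b : ℕ) = a + i then 1 else 0 := by
    intro a b
    simp only [uTest, Matrix.submatrix_apply, Fin.revPerm_apply, Fin.rev_rev, Matrix.of_apply, id]
  have hB : ((uTest n K i).submatrix Fin.revPerm id).BlockTriangular id := by
    intro a b hab
    have : (b : ℕ) < a := hab
    rw [hCe, if_neg (by omega)]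
  have hCd : ((uTest n K i).submatrix Fin.revPerm id).det = 1 := by
    rw [Matrix.det_of_isUpperTriangular hB]
    apply Finset.prod_eq_one
    intro a _
    rw [hCe, if_pos (Or.inl rfl)]
  have hd : (uTest n K i).det ≠ 0 := by
    intro h
    rw [Matrix.det_permute, h, mul_zero] at hCd
    exact zero_ne_one hCd
  obtain ⟨ε, hε, hj⟩ := Jki_anti _ hB hd k i hk hik
  rw [hj]
  refine mul_ne_zero ?_ (mul_ne_zero ?_ ?_)
  · rcases hε with rfl | rfl <;> simp
  · rw [uMinor, Matrix.det_of_isLowerTriangular]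
    · apply Finset.prod_ne_zero_iff.mpr
      intro r _
      rw [Matrix.submatrix_apply, hCe, if_pos (Or.inr (by simp; omega))]
      exact one_ne_zero
    · intro r c hrc
      have hrc' : (r : ℕ) < c := hrc
      rw [Matrix.submatrix_apply, hCe, if_neg (by simp; omega)]
  · refine Finset.prod_ne_zero_iff.mpr fun r _ => mul_ne_zero hd ?_
    exact left_ne_zero_of_mul ((Uinv_diag_inv _ hB (Uinv_rev_det_isUnit _ hd) _).trans_ne
      one_ne_zero)

theorem Jki_genMatrix_ne_zero {n : ℕ} {K : Type*} [Field K] (k i : ℕ) (hk : k ≤ n)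
    (hik : i < k) : Jki k i hk hik (genMatrix K n) ≠ 0 := by
  intro h
  apply Jki_uTest_ne_zero (K := K) k i hk hik
  have := Jki_map k i hk hik (MvPolynomial.eval fun ab => uTest n K i ab.1 ab.2) (genMatrix K n)
  rw [h, map_zero] at this
  rw [this]
  congr 1
  ext a b
  simp [genMatrix]

/-! ### Reduction to antitriangular form -/

theorem Jki_zero_eq {n : ℕ} {R : Type*} [CommRing R] (m : ℕ) (hm : m ≤ n) (h0 : 0 < m)
    (A : Matrix (Fin n) (Fin n) R) :
    Jki m 0 hm h0 A = (A.submatrix (fun s : Fin m => (⟨n - m + s, by have := s.isLt; omega⟩ : Fin n))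
      (Fin.castLE hm)).det := by
  unfold Jki
  congr 1
  ext r c
  have hr := r.isLt
  simp only [Matrix.of_apply, Matrix.submatrix_apply]
  rw [dif_pos (by omega)]
  rfl

theorem Jki_full_eq {n : ℕ} {R : Type*} [CommRing R] (h0 : 0 < n)
    (A : Matrix (Fin n) (Fin n) R) : Jki n 0 le_rfl h0 A = A.det := by
  rw [Jki_zero_eq]
  congr 1
  ext r c
  simp only [Matrix.submatrix_apply]
  congr 1
  apply Fin.ext
  simp

theorem Uinv_exists_row {n : ℕ} {L : Type*} [Field L] (A : Matrix (Fin n) (Fin n) L)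
    (hJ : ∀ m (hm : m ≤ n) (h0 : 0 < m), Jki m 0 hm h0 A ≠ 0) (a : Fin n) :
    ∃ r : Fin n → L, r a = 1 ∧ (∀ a', a' < a → r a' = 0) ∧
      ∀ b : Fin n, b < Fin.rev a → ∑ a', r a' * A a' b = 0 := by
  obtain ⟨m, hm⟩ : ∃ m, m = n - 1 - (a : ℕ) := ⟨_, rfl⟩
  have ha := a.isLt
  have hmn : m ≤ n := by omega
  let emb : Fin m → Fin n := fun s => ⟨n - m + s, by have := s.isLt; omega⟩
  let N := A.submatrix emb (Fin.castLE hmn)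
  have hN : IsUnit N.det := by
    rcases Nat.eq_zero_or_pos m with h | h
    · subst h; simp
    · have := hJ m hmn h
      rw [Jki_zero_eq] at this
      exact this.isUnit
  let x : Fin m → L := fun c => - A a (Fin.castLE hmn c)
  let v : Fin m → L := Matrix.vecMul x N⁻¹
  have hv : Matrix.vecMul v N = x := by
    simp only [v, Matrix.vecMul_vecMul, Matrix.nonsing_inv_mul N hN, Matrix.vecMul_one]
  let t : Fin n → L := fun a' =>
    if h : a < a' then v ⟨(a' : ℕ) - (n - m), by
      have := a'.isLt
      have h' : (a : ℕ) < a' := h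
      omega⟩ else 0
  refine ⟨fun a' => (if a' = a then 1 else 0) + t a', ?_, ?_, ?_⟩
  · simp [t]
  · intro a' h
    have h1 : a' ≠ a := ne_of_lt h
    have h2 : ¬ a < a' := not_lt_of_gt h
    simp [t, h1, h2]
  · intro b hb
    have hb' : (b : ℕ) < m := by
      have : (b : ℕ) < (Fin.rev a : Fin n) := hb
      rw [Fin.val_rev] at this
      omega
    have h1 : ∑ s : Fin m, v s * N s ⟨b, hb'⟩ = - A a b := congrFun hv ⟨b, hb'⟩
    have h2 : ∑ s : Fin m, v s * N s ⟨b, hb'⟩ = ∑ a', t a' * A a' b := by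
      apply Fintype.sum_of_injective emb
      · intro s s' h
        apply Fin.ext
        have := congrArg Fin.val h
        simp only [emb] at this
        omega
      · intro a' ha'
        have hlt : ¬ a < a' := by
          intro h
          have h' : (a : ℕ) < a' := h
          have := a'.isLt
          apply ha'
          refine ⟨⟨(a' : ℕ) - (n - m), by omega⟩, ?_⟩
          apply Fin.ext
          simp only [emb]
          omega
        simp [t, hlt]
      · intro s
        have hlt : a < emb s := by
          show (a : ℕ) < n - m + s
          omega
        simp only [t, hlt, dif_pos]
        congr 2
        apply Fin.ext
        simp [emb]
    simp only [add_mul, Finset.sum_add_distrib, ite_mul, one_mul, zero_mul, Finset.sum_ite_eq',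
      Finset.mem_univ, if_true]
    rw [← h2, h1]
    ring

theorem Uinv_exists_conj {n : ℕ} {L : Type*} [Field L] (A : Matrix (Fin n) (Fin n) L)
    (hJ : ∀ m (hm : m ≤ n) (h0 : 0 < m), Jki m 0 hm h0 A ≠ 0) :
    ∃ h : Matrix (Fin n) (Fin n) L, IsUniUpperTriangular h ∧
      ((h * A * h⁻¹).submatrix Fin.revPerm id).BlockTriangular id := by
  choose r h1 h2 h3 using Uinv_exists_row A hJ
  have hu : IsUniUpperTriangular (Matrix.of r) := ⟨h1, fun a b hab => h2 a b hab⟩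
  refine ⟨Matrix.of r, hu, ?_⟩
  intro a b hab
  have hab' : b < a := hab
  rw [Matrix.submatrix_apply, Matrix.mul_apply]
  apply Finset.sum_eq_zero
  intro c _
  by_cases hc : b < c
  · have : ((Matrix.of r)⁻¹ : Matrix (Fin n) (Fin n) L) c (id b) = 0 := hu.inv'.2 _ _ hc
    rw [this, mul_zero]
  · have : (Matrix.of r * A) (Fin.revPerm a) c = 0 := by
      rw [Matrix.mul_apply]
      apply h3
      rw [Fin.revPerm_apply, Fin.rev_rev]
      exact lt_of_le_of_lt (not_lt.mp hc) hab'
    rw [this, zero_mul]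

/-! ### Density of `U(K)` -/

/-- Evaluate a polynomial in matrix entries at a matrix. -/
noncomputable def evM {n : ℕ} {K S : Type*} [CommRing K] [CommRing S] [Algebra K S]
    (M : Matrix (Fin n) (Fin n) S) (p : MvPolynomial (Fin n × Fin n) K) : S :=
  MvPolynomial.aeval (fun ab => M ab.1 ab.2) p

theorem map_evM {n : ℕ} {K S T : Type*} [CommRing K] [CommRing S] [CommRing T] [Algebra K S]
    [Algebra K T] (f : S →+* T) (hf : ∀ c, f (algebraMap K S c) = algebraMap K T c)
    (M : Matrix (Fin n) (Fin n) S) (p : MvPolynomial (Fin n × Fin n) K) :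
    f (evM M p) = evM (M.map f) p := by
  let f' : S →ₐ[K] T := { f with commutes' := hf }
  have : f' (evM M p) = evM (M.map f) p := by
    unfold evM
    rw [← AlgHom.comp_apply, MvPolynomial.comp_aeval]
    rfl
  exact this

theorem evM_gen {n : ℕ} {K : Type*} [CommRing K] (p : MvPolynomial (Fin n × Fin n) K) :
    evM (genMatrix K n) p = p := by
  unfold evM genMatrix
  exact MvPolynomial.aeval_X_left_apply p

theorem evM_mem {n : ℕ} {K L : Type*} [Field K] [Field L] [Algebra K L] (F : Subfield L)
    (hK : ∀ c, algebraMap K L c ∈ F) (M : Matrix (Fin n) (Fin n) L) (hM : ∀ a b, M a b ∈ F)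
    (p : MvPolynomial (Fin n × Fin n) K) : evM M p ∈ F := by
  unfold evM
  induction p using MvPolynomial.induction_on with
  | C c => simpa using hK c
  | add p q hp hq => rw [map_add]; exact add_mem hp hq
  | mul_X p ab hp => rw [map_mul, MvPolynomial.aeval_X]; exact mul_mem hp (hM _ _)

/-- The unitriangular matrix with given entries above the diagonal. -/
def uMk {n : ℕ} {R : Type*} [CommRing R] (y : Fin n × Fin n → R) : Matrix (Fin n) (Fin n) R :=
  Matrix.of fun a b => if a < b then y (a, b) else if a = b then 1 else 0

theorem uMk_map {n : ℕ} {R S : Type*} [CommRing R] [CommRing S] (f : R →+* S)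
    (y : Fin n × Fin n → R) : (uMk y).map f = uMk (fun ab => f (y ab)) := by
  ext a b
  simp only [uMk, Matrix.map_apply, Matrix.of_apply]
  split_ifs <;> simp

theorem uMk_uni {n : ℕ} {R : Type*} [CommRing R] (y : Fin n × Fin n → R) :
    IsUniUpperTriangular (uMk y) := by
  refine ⟨fun a => by simp [uMk], fun a b hab => ?_⟩
  have h : b < a := hab
  simp [uMk, not_lt_of_gt h, ne_of_gt h]

theorem uMk_eq {n : ℕ} {R : Type*} [CommRing R] (u : Matrix (Fin n) (Fin n) R)
    (hu : IsUniUpperTriangular u) : uMk (fun ab => u ab.1 ab.2) = u := by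
  ext a b
  simp only [uMk, Matrix.of_apply]
  split_ifs with h1 h2
  · rfl
  · subst h2; exact (hu.1 a).symm
  · exact (hu.2 a b (show b < a from lt_of_le_of_ne (not_lt.mp h1) (Ne.symm h2))).symm

theorem IsUniUpperTriangular.inv_eq {n : ℕ} {R : Type*} [Field R]
    {u : Matrix (Fin n) (Fin n) R} (hu : IsUniUpperTriangular u) : u⁻¹ = u.adjugate := by
  rw [Matrix.inv_def, hu.det_one', Ring.inverse_one, one_smul]

theorem Uinv_map_adjugate {n : ℕ} {R S : Type*} [CommRing R] [CommRing S] (f : R →+* S)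
    (u : Matrix (Fin n) (Fin n) R) : u.adjugate.map f = (u.map f).adjugate := by
  simpa using f.map_adjugate u

theorem Uinv_density {σ K L : Type*} [Field K] [Infinite K] [Field L] [Algebra K L]
    (G : MvPolynomial σ L)
    (h : ∀ y : σ → K, MvPolynomial.eval (fun s => algebraMap K L (y s)) G = 0) : G = 0 := by
  apply MvPolynomial.funext_set (fun _ => Set.range (algebraMap K L))
    (fun _ => Set.infinite_range_of_injective (algebraMap K L).injective)
  intro x hx
  choose y hy using fun s => hx s (Set.mem_univ s)
  rw [map_zero, ← h y]
  congr 2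
  funext s
  exact (hy s).symm

/-- Evaluation of the universal conjugate. -/
theorem eval_evM {n : ℕ} {K L : Type*} [Field K] [Field L] [Algebra K L] (g : Fin n × Fin n → L)
    (M : Matrix (Fin n) (Fin n) (MvPolynomial (Fin n × Fin n) L))
    (p : MvPolynomial (Fin n × Fin n) K) :
    MvPolynomial.eval g (evM M p) = evM (M.map (MvPolynomial.eval g)) p := by
  apply map_evM
  intro c
  rw [MvPolynomial.algebraMap_apply, MvPolynomial.eval_C]

section core

variable {n : ℕ} {K L : Type*} [Field K] [Field L]
  [Algebra (MvPolynomial (Fin n × Fin n) K) L] [Algebra K L]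
  [IsScalarTower K (MvPolynomial (Fin n × Fin n) K) L]

theorem algebraMap_rho (u : Matrix (Fin n) (Fin n) K) (hu : IsUniUpperTriangular u)
    (p : MvPolynomial (Fin n × Fin n) K) :
    algebraMap _ L (rho u p) =
      evM ((u.map (algebraMap K L)).adjugate *
        (genMatrix K n).map (algebraMap (MvPolynomial (Fin n × Fin n) K) L) *
          u.map (algebraMap K L)) p := by
  have h : rho u p = evM ((u⁻¹).map MvPolynomial.C * genMatrix K n * u.map MvPolynomial.C) p := rfl
  rw [h, map_evM (algebraMap _ L) (fun c => (IsScalarTower.algebraMap_apply K _ L c).symm),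
    Matrix.map_mul, Matrix.map_mul, hu.inv_eq, Uinv_map_adjugate, Uinv_map_adjugate]
  have : (u.map MvPolynomial.C).map (algebraMap (MvPolynomial (Fin n × Fin n) K) L) =
      u.map (algebraMap K L) := by
    ext a b
    exact (IsScalarTower.algebraMap_apply K (MvPolynomial (Fin n × Fin n) K) L (u a b)).symm
  rw [this]

theorem rho_inv_rho (u : Matrix (Fin n) (Fin n) K) (hu : IsUniUpperTriangular u)
    (p : MvPolynomial (Fin n × Fin n) K) : rho u⁻¹ (rho u p) = p := by
  have hd : IsUnit u.det := by rw [hu.det_one']; exact isUnit_one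
  have hXm : (genMatrix K n).map (rho u⁻¹) =
      u.map MvPolynomial.C * genMatrix K n * (u⁻¹).map MvPolynomial.C := by
    ext1 a b
    rw [Matrix.map_apply]
    simp only [genMatrix, rho, Matrix.of_apply, MvPolynomial.aeval_X,
      Matrix.nonsing_inv_nonsing_inv u hd]
  have hC : ∀ v : Matrix (Fin n) (Fin n) K,
      (v.map (MvPolynomial.C (σ := Fin n × Fin n))).map (rho u⁻¹) = v.map MvPolynomial.C := by
    intro v
    ext1 a b
    rw [Matrix.map_apply, Matrix.map_apply]
    exact (rho u⁻¹).commutes (v a b)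
  have h : rho u p = evM ((u⁻¹).map MvPolynomial.C * genMatrix K n * u.map MvPolynomial.C) p := rfl
  have h1 : (u⁻¹).map (MvPolynomial.C (σ := Fin n × Fin n)) * u.map MvPolynomial.C = 1 := by
    rw [← Matrix.map_mul, Matrix.nonsing_inv_mul u hd]
    exact Matrix.map_one _ (map_zero _) (map_one _)
  have hm := map_evM (rho u⁻¹).toRingHom
    (fun c => (rho u⁻¹).commutes c)
    ((u⁻¹).map MvPolynomial.C * genMatrix K n * u.map MvPolynomial.C) p
  rw [h]
  refine hm.trans ?_
  have e : ((u⁻¹).map MvPolynomial.C * genMatrix K n * u.map MvPolynomial.C).map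
      (rho u⁻¹).toRingHom = genMatrix K n := by
    rw [Matrix.map_mul, Matrix.map_mul]
    have e1 := hC u⁻¹
    have e2 := hC u
    change ((u⁻¹).map MvPolynomial.C).map (rho u⁻¹) * (genMatrix K n).map (rho u⁻¹) *
      (u.map MvPolynomial.C).map (rho u⁻¹) = _
    rw [e1, e2, hXm]
    simp only [← mul_assoc]
    rw [h1, one_mul, mul_assoc, h1, mul_one]
  rw [e, evM_gen]

theorem Uinv_core [CharZero K] [FaithfulSMul (MvPolynomial (Fin n × Fin n) K) L] (hn : 1 ≤ n)
    (F : Subfield L)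
    (hK : ∀ c, algebraMap K L c ∈ F)
    (hJ : ∀ k i (hk : k ≤ n) (hik : i < k), algebraMap (MvPolynomial (Fin n × Fin n) K) L
      (Jki k i hk hik (genMatrix K n)) ∈ F)
    (p q : MvPolynomial (Fin n × Fin n) K) (hq : q ≠ 0) (hpq : IsRelPrime p q)
    (hinv : ∀ u : Matrix (Fin n) (Fin n) K, IsUniUpperTriangular u →
      rho u p * q = p * rho u q) :
    algebraMap _ L p / algebraMap _ L q ∈ F := by
  have hinj : Function.Injective (algebraMap (MvPolynomial (Fin n × Fin n) K) L) :=
    FaithfulSMul.algebraMap_injective _ _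
  have hdvd : ∀ u : Matrix (Fin n) (Fin n) K, IsUniUpperTriangular u → q ∣ rho u q := by
    intro u hu
    exact hpq.symm.dvd_of_dvd_mul_left ⟨rho u p, by rw [← hinv u hu, mul_comm]⟩
  have hsq : ∀ u : Matrix (Fin n) (Fin n) K, IsUniUpperTriangular u →
      rho u q * rho u⁻¹ q = q ^ 2 := by
    intro u hu
    obtain ⟨c, hc⟩ := hdvd u hu
    obtain ⟨d, hd⟩ := hdvd u⁻¹ hu.inv'
    have h1 : q = q * (d * rho u⁻¹ c) := by
      have := rho_inv_rho u hu q
      rw [hc, map_mul, hd] at this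
      rw [← mul_assoc, this]
    have h2 : d * rho u⁻¹ c = 1 := by
      apply mul_left_cancel₀ hq
      rw [← h1, mul_one]
    have hdu : IsUnit d := IsUnit.of_mul_eq_one _ h2
    rw [MvPolynomial.isUnit_iff_eq_C_of_isReduced] at hdu
    obtain ⟨e, he, rfl⟩ := hdu
    have h3 : rho u (MvPolynomial.C e) = MvPolynomial.C e := (rho u).commutes e
    have h4 : MvPolynomial.C e * c = 1 := by
      have hu2 : rho u (rho u⁻¹ c) = c := by
        have := rho_inv_rho u⁻¹ hu.inv' c
        rwa [Matrix.nonsing_inv_nonsing_inv u (by rw [hu.det_one']; exact isUnit_one)] at this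
      have := congrArg (rho u) h2
      rwa [map_mul, h3, hu2, map_one] at this
    rw [hc, hd]
    linear_combination q ^ 2 * h4
  set XL := (genMatrix K n).map (algebraMap (MvPolynomial (Fin n × Fin n) K) L) with hXL
  have hJX : ∀ k i (hk : k ≤ n) (hik : i < k), Jki k i hk hik XL =
      algebraMap (MvPolynomial (Fin n × Fin n) K) L (Jki k i hk hik (genMatrix K n)) :=
    fun k i hk hik => (Jki_map k i hk hik _ _).symm
  have hJX0 : ∀ k i (hk : k ≤ n) (hik : i < k), Jki k i hk hik XL ≠ 0 := by
    intro k i hk hik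
    rw [hJX]
    exact (map_ne_zero_iff _ hinj).mpr (Jki_genMatrix_ne_zero k i hk hik)
  obtain ⟨h, hh, hB⟩ := Uinv_exists_conj XL (fun m hm h0 => hJX0 m 0 hm h0)
  have hhd : IsUnit h.det := by rw [hh.det_one']; exact isUnit_one
  set g := h⁻¹ with hg
  have hgu : IsUniUpperTriangular g := hh.inv'
  have hhg : h * g = 1 := Matrix.mul_nonsing_inv h hhd
  have hgadj : g.adjugate = h := by
    rw [← hgu.inv_eq, hg, Matrix.nonsing_inv_nonsing_inv h hhd]
  set B := h * XL * g with hBdef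
  have hJB : ∀ k i (hk : k ≤ n) (hik : i < k), Jki k i hk hik B = Jki k i hk hik XL :=
    fun k i hk hik => Jki_conj k i hk hik XL h g hh hgu hhg
  have hBdet : B.det = Jki n 0 le_rfl hn B := (Jki_full_eq hn B).symm
  have hBF : ∀ a b, B a b ∈ F := by
    apply Uinv_anti_mem F B hB
    · rw [hBdet, hJB]; exact hJX0 _ _ _ _
    · rw [hBdet, hJB, hJX]; exact hJ _ _ _ _
    · intro k i hk hik; rw [hJB, hJX]; exact hJ _ _ _ _
    · intro k i hk hik; rw [hJB]; exact hJX0 _ _ _ _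
  -- polynomial identities
  have : Infinite K := inferInstance
  let uG : Matrix (Fin n) (Fin n) (MvPolynomial (Fin n × Fin n) L) := uMk MvPolynomial.X
  let XC : Matrix (Fin n) (Fin n) (MvPolynomial (Fin n × Fin n) L) := XL.map MvPolynomial.C
  have huG : ∀ y : Fin n × Fin n → L, uG.map (MvPolynomial.eval y) = uMk y := by
    intro y
    simp only [uG, uMk_map, MvPolynomial.eval_X]
  have hXC : ∀ y : Fin n × Fin n → L, XC.map (MvPolynomial.eval y) = XL := by
    intro y
    ext a b
    simp [XC]
  let P₁ : MvPolynomial (Fin n × Fin n) K → MvPolynomial (Fin n × Fin n) L :=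
    fun p => evM (uG.adjugate * XC * uG) p
  let P₂ : MvPolynomial (Fin n × Fin n) K → MvPolynomial (Fin n × Fin n) L :=
    fun p => evM (uG * XC * uG.adjugate) p
  have hP₁ : ∀ y p, MvPolynomial.eval y (P₁ p) = evM ((uMk y).adjugate * XL * uMk y) p := by
    intro y p
    simp only [P₁]
    rw [eval_evM, Matrix.map_mul, Matrix.map_mul, Uinv_map_adjugate, huG, hXC]
  have hP₂ : ∀ y p, MvPolynomial.eval y (P₂ p) = evM (uMk y * XL * (uMk y).adjugate) p := by
    intro y p
    simp only [P₂]
    rw [eval_evM, Matrix.map_mul, Matrix.map_mul, Uinv_map_adjugate, huG, hXC]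
  have hK₁ : ∀ (y : Fin n × Fin n → K) p,
      MvPolynomial.eval (fun s => algebraMap K L (y s)) (P₁ p) =
        algebraMap _ L (rho (uMk y) p) := by
    intro y p
    rw [hP₁, algebraMap_rho _ (uMk_uni y), uMk_map]
  have hK₂ : ∀ (y : Fin n × Fin n → K) p,
      MvPolynomial.eval (fun s => algebraMap K L (y s)) (P₂ p) =
        algebraMap _ L (rho (uMk y)⁻¹ p) := by
    intro y p
    have hy := uMk_uni y
    have e : (uMk y)⁻¹.adjugate = uMk y := by
      rw [← hy.inv'.inv_eq, Matrix.nonsing_inv_nonsing_inv _ (by rw [hy.det_one']; exact isUnit_one)]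
    rw [hP₂, algebraMap_rho _ hy.inv', ← Uinv_map_adjugate, e, hy.inv_eq, Uinv_map_adjugate,
      uMk_map]
  have G₁ : P₁ p * MvPolynomial.C (algebraMap _ L q) -
      MvPolynomial.C (algebraMap _ L p) * P₁ q = 0 := by
    apply Uinv_density (K := K)
    intro y
    rw [map_sub, map_mul, map_mul, MvPolynomial.eval_C, MvPolynomial.eval_C, hK₁, hK₁, ← map_mul,
      ← map_mul, hinv _ (uMk_uni y), sub_self]
  have G₂ : P₁ q * P₂ q - MvPolynomial.C (algebraMap _ L q ^ 2) = 0 := by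
    apply Uinv_density (K := K)
    intro y
    rw [map_sub, map_mul, MvPolynomial.eval_C, hK₁, hK₂, ← map_mul, hsq _ (uMk_uni y), map_pow,
      sub_self]
  have hBe : ∀ p, MvPolynomial.eval (fun ab => g ab.1 ab.2) (P₁ p) = evM B p := by
    intro p
    rw [hP₁, uMk_eq g hgu, hgadj]
  have E₁ := congrArg (MvPolynomial.eval (fun ab : Fin n × Fin n => g ab.1 ab.2)) G₁
  have E₂ := congrArg (MvPolynomial.eval (fun ab : Fin n × Fin n => g ab.1 ab.2)) G₂
  rw [map_sub, map_mul, map_mul, MvPolynomial.eval_C, MvPolynomial.eval_C, hBe, hBe, map_zero,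
    sub_eq_zero] at E₁
  rw [map_sub, map_mul, MvPolynomial.eval_C, hBe, map_zero, sub_eq_zero] at E₂
  have hqL : algebraMap _ L q ≠ 0 := (map_ne_zero_iff _ hinj).mpr hq
  have hqB : evM B q ≠ 0 := left_ne_zero_of_mul (E₂.trans_ne (pow_ne_zero 2 hqL))
  have : algebraMap _ L p / algebraMap _ L q = evM B p / evM B q := by
    rw [div_eq_div_iff hqL hqB, E₁]
  rw [this]
  exact div_mem (evM_mem F hK B hBF p) (evM_mem F hK B hBF q)

end core

/-- The field of `U`-invariant rational functions `K(M)^U` of the adjoint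
representation of `GL(n,K)` equals the subfield of `K(M)` generated over `K`
by the `n(n+1)/2` polynomials `J_{k,i}`, `1 ≤ k ≤ n`, `0 ≤ i ≤ k-1`.  Here the
action of `U` on `K(M)`, the fraction field of `K[x]`, is by the (unique)
extension `ρ'` of `ρ` to the fraction field. -/
theorem field_of_U_invariants_eq {n : ℕ} {K : Type*} [Field K] [CharZero K]
    (hn : 1 ≤ n)
    (ρ' : Matrix (Fin n) (Fin n) K →
      (FractionRing (MvPolynomial (Fin n × Fin n) K) →+*
        FractionRing (MvPolynomial (Fin n × Fin n) K)))
    (hρ' : ∀ u : Matrix (Fin n) (Fin n) K, IsUniUpperTriangular u →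
      ∀ p : MvPolynomial (Fin n × Fin n) K,
        ρ' u (algebraMap _ _ p) = algebraMap _ _ (rho u p)) :
    {f : FractionRing (MvPolynomial (Fin n × Fin n) K) |
        ∀ u : Matrix (Fin n) (Fin n) K, IsUniUpperTriangular u → ρ' u f = f} =
      (Subfield.closure
        (Set.range (algebraMap K (FractionRing (MvPolynomial (Fin n × Fin n) K))) ∪
          {g | ∃ (k i : ℕ) (hk : k ≤ n) (hik : i < k),
            g = algebraMap (MvPolynomial (Fin n × Fin n) K) _
              (Jki k i hk hik (genMatrix K n))}) :
        Set (FractionRing (MvPolynomial (Fin n × Fin n) K))) := by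
  classical
  apply Set.Subset.antisymm
  · intro f hf
    have hf' : ∀ u : Matrix (Fin n) (Fin n) K, IsUniUpperTriangular u → ρ' u f = f := hf
    have hfe := IsFractionRing.mk'_num_den' (MvPolynomial (Fin n × Fin n) K) f
    set p := IsFractionRing.num (MvPolynomial (Fin n × Fin n) K) f with hp
    set q : MvPolynomial (Fin n × Fin n) K :=
      (IsFractionRing.den (MvPolynomial (Fin n × Fin n) K) f).1 with hqdef
    have hq : q ≠ 0 := nonZeroDivisors.coe_ne_zero _
    have hinj : Function.Injective (algebraMap (MvPolynomial (Fin n × Fin n) K)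
      (FractionRing (MvPolynomial (Fin n × Fin n) K))) := IsFractionRing.injective _ _
    rw [← hfe]
    apply Uinv_core (K := K) hn
    · intro c
      exact Subfield.subset_closure (Or.inl ⟨c, rfl⟩)
    · intro k i hk hik
      exact Subfield.subset_closure (Or.inr ⟨k, i, hk, hik, rfl⟩)
    · exact hq
    · exact IsFractionRing.num_den_reduced _ f
    · intro u hu
      have h1 := hf' u hu
      have hqL := (map_ne_zero_iff _ hinj).mpr hq
      have hqL' := (map_ne_zero_iff _ (ρ' u).injective).mpr hqL
      rw [← hfe, map_div₀, div_eq_div_iff hqL' hqL, hρ' u hu, hρ' u hu, ← map_mul, ← map_mul] at h1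
      exact hinj h1
  · intro f hf u hu
    have hle : Subfield.closure
        (Set.range (algebraMap K (FractionRing (MvPolynomial (Fin n × Fin n) K))) ∪
          {g | ∃ (k i : ℕ) (hk : k ≤ n) (hik : i < k),
            g = algebraMap (MvPolynomial (Fin n × Fin n) K) _
              (Jki k i hk hik (genMatrix K n))}) ≤
        (ρ' u).eqLocusField (RingHom.id _) := by
      rw [Subfield.closure_le]
      rintro x (⟨c, rfl⟩ | ⟨k, i, hk, hik, rfl⟩)
      · show ρ' u _ = _
        rw [IsScalarTower.algebraMap_apply K (MvPolynomial (Fin n × Fin n) K), hρ' u hu,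
          AlgHom.commutes]
        rfl
      · show ρ' u _ = _
        rw [hρ' u hu]
        have h1 := Jki_map k i hk hik
          (rho u).toRingHom (genMatrix K n)
        have h2 : (genMatrix K n).map
            (rho u).toRingHom =
            (u⁻¹).map MvPolynomial.C * genMatrix K n * u.map MvPolynomial.C := by
          ext1 a b
          rw [Matrix.map_apply]
          change rho u (MvPolynomial.X (a, b)) = _
          simp only [rho, MvPolynomial.aeval_X]
        have hmap : ∀ v : Matrix (Fin n) (Fin n) K, IsUniUpperTriangular v →
            IsUniUpperTriangular (v.map (MvPolynomial.C (σ := Fin n × Fin n))) := by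
          intro v hv
          exact ⟨fun a => by simp [hv.1], fun a b hab => by simp [hv.2 a b hab]⟩
        rw [h2, Jki_conj k i hk hik _ _ _ (hmap _ hu.inv') (hmap _ hu)] at h1
        · exact congrArg _ h1
        · rw [← Matrix.map_mul, Matrix.nonsing_inv_mul u (by rw [hu.det_one']; exact isUnit_one)]
          exact Matrix.map_one _ (map_zero _) (map_one _)
    exact hle hf
end

section
/- For every pair (k,i) ∈ T there exist rational functions φ, ψ ∈ K(s) lying in the subfield of K(s) generated over K by the variables s_{a,b} that are strictly smaller than s_{k,i} in the given order, with φ ≠ 0, such that π(J_{k,i}) = φ·s_{k,i} + ψ holds in K(s). -/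
open Matrix MvPolynomial

/-- The index set `T = {(k,i) : 1 ≤ k ≤ n, 0 ≤ i ≤ k-1}`. -/
def TIdx (n : ℕ) := {p : ℕ × ℕ // p.1 ≤ n ∧ p.2 < p.1}

/-- The `K`-algebra homomorphism `π : K[x] → K[s]` with
`π(x_{ab}) = s_{b, a+b-n-1}` if `a + b ≥ n + 1` (1-indexed) and
`π(x_{ab}) = 0` if `a + b ≤ n`. -/
noncomputable def piHom (K : Type*) [CommRing K] (n : ℕ) :
    MvPolynomial (Fin n × Fin n) K →ₐ[K] MvPolynomial (TIdx n) K :=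
  MvPolynomial.aeval fun ab =>
    if h : n ≤ (ab.1 : ℕ) + (ab.2 : ℕ) + 1 then
      MvPolynomial.X (⟨((ab.2 : ℕ) + 1, (ab.1 : ℕ) + (ab.2 : ℕ) + 1 - n),
        by have := ab.1.isLt; have := ab.2.isLt; omega⟩ : TIdx n)
    else 0

/-- The rank of the variable `s_{k,i}` in the linear order
`s_{1,0} < … < s_{n,0} < s_{2,1} < s_{3,2} < s_{3,1} < … < s_{n,n-1} < … < s_{n,1}`:
first all `s_{k,0}` ordered by `k`, then for `k = 2, …, n` the groups
`s_{k,k-1} < s_{k,k-2} < … < s_{k,1}`. -/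
def rankS (n : ℕ) (t : TIdx n) : ℕ :=
  if t.1.2 = 0 then t.1.1
  else n + (t.1.1 - 1) * (t.1.1 - 2) / 2 + (t.1.1 - t.1.2)

section helpers

theorem aux_det_equiv {m l R : Type*} [Fintype m] [DecidableEq m] [Fintype l] [DecidableEq l]
    [CommRing R] (M : Matrix l l R) (e₁ e₂ : m ≃ l) :
    ∃ ε : R, (ε = 1 ∨ ε = -1) ∧ M.det = ε * (M.submatrix e₁ e₂).det := by
  have h : M.submatrix e₁ e₂ = (M.submatrix (e₂.symm.trans e₁) id).submatrix e₂ e₂ := by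
    ext a b; simp
  have h2 := Matrix.det_permute (e₂.symm.trans e₁) M
  rw [h, Matrix.det_submatrix_equiv_self, h2]
  rcases Int.units_eq_one_or (Equiv.Perm.sign (e₂.symm.trans e₁)) with h3 | h3
  · exact ⟨1, Or.inl rfl, by rw [h3]; simp⟩
  · exact ⟨-1, Or.inr rfl, by rw [h3]; simp⟩

theorem aux_det_anti {k : ℕ} {R : Type*} [CommRing R] (M : Matrix (Fin k) (Fin k) R)
    (h : ∀ r c : Fin k, (r : ℕ) + c + 1 < k → M r c = 0) :
    ∃ ε : R, (ε = 1 ∨ ε = -1) ∧ M.det = ε * ∏ c, M (Fin.rev c) c := by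
  obtain ⟨ε, hε, h1⟩ := aux_det_equiv M Fin.revPerm (Equiv.refl _)
  refine ⟨ε, hε, ?_⟩
  rw [h1, Matrix.det_of_isUpperTriangular]
  · simp
  · intro r c hrc
    have hrc' : (c : ℕ) < r := hrc
    apply h
    simp [Fin.val_rev]
    omega

theorem aux_det_anti' {k : ℕ} {R : Type*} [CommRing R] (M : Matrix (Fin k) (Fin k) R)
    (h : ∀ r c : Fin k, k < (r : ℕ) + c + 1 → M r c = 0) :
    ∃ ε : R, (ε = 1 ∨ ε = -1) ∧ M.det = ε * ∏ c, M (Fin.rev c) c := by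
  obtain ⟨ε, hε, h1⟩ := aux_det_equiv M Fin.revPerm (Equiv.refl _)
  refine ⟨ε, hε, ?_⟩
  rw [h1, Matrix.det_of_isLowerTriangular]
  · simp
  · intro r c hrc
    have hrc' : (r : ℕ) < c := hrc
    apply h
    simp [Fin.val_rev]
    omega

theorem aux_det_mem {m L : Type*} [Fintype m] [DecidableEq m] [Field L] (F : Subfield L)
    (M : Matrix m m L) (h : ∀ i j, M i j ∈ F) : M.det ∈ F := by
  rw [Matrix.det_apply']
  exact sum_mem fun σ _ => mul_mem (intCast_mem F _) (prod_mem fun i _ => h _ _)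

theorem aux_sign_mem {L : Type*} [Field L] (F : Subfield L) {ε : L} (h : ε = 1 ∨ ε = -1) :
    ε ∈ F ∧ ε ≠ 0 := by
  rcases h with rfl | rfl
  · exact ⟨one_mem _, one_ne_zero⟩
  · exact ⟨neg_mem (one_mem _), by simp⟩

/-- adjugate of an anti-triangular matrix is anti-triangular -/
theorem aux_adj_zero {n : ℕ} {L : Type*} [Field L] (S : Matrix (Fin n) (Fin n) L)
    (h : ∀ r c : Fin n, (r : ℕ) + c + 1 < n → S r c = 0) (hdet : S.det ≠ 0)
    (a c : Fin n) (hac : n < (a : ℕ) + c + 1) : S.adjugate a c = 0 := by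
  have htri : (S.submatrix Fin.revPerm (Equiv.refl _)).BlockTriangular id := by
    intro r c hrc
    have hrc' : (c : ℕ) < r := hrc
    apply h
    simp [Fin.val_rev]
    omega
  obtain ⟨ε, hε, h1⟩ := aux_det_equiv S Fin.revPerm (Equiv.refl _)
  have hd' : (S.submatrix Fin.revPerm (Equiv.refl _)).det ≠ 0 := by
    intro h0; rw [h0] at h1; simp at h1; exact hdet h1
  haveI : Invertible (S.submatrix Fin.revPerm (Equiv.refl _)) :=
    Matrix.invertibleOfIsUnitDet _ (isUnit_iff_ne_zero.2 hd')
  have hinv := Matrix.blockTriangular_inv_of_blockTriangular htri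
  rw [Matrix.inv_submatrix_equiv] at hinv
  have h2 := @hinv a (Fin.rev c) (by
    show Fin.rev c < a
    rw [Fin.lt_def, Fin.val_rev]; omega)
  simp [Matrix.inv_def] at h2
  exact h2.resolve_left hdet

theorem aux_adj_anti {n : ℕ} {L : Type*} [Field L] (S : Matrix (Fin n) (Fin n) L)
    (h : ∀ r c : Fin n, (r : ℕ) + c + 1 < n → S r c = 0) (hdet : S.det ≠ 0)
    (a c : Fin n) (hac : (a : ℕ) + c + 1 = n) : S.adjugate a c * S c a = S.det := by
  have h1 := congrFun (congrFun (Matrix.adjugate_mul S) a) a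
  rw [Matrix.mul_apply, Finset.sum_eq_single c] at h1
  · simpa using h1
  · intro b _ hb
    have hb' : (b : ℕ) ≠ c := fun h => hb (Fin.ext h)
    rcases lt_or_gt_of_ne hb' with h2 | h2
    · rw [h b a (by omega), mul_zero]
    · rw [aux_adj_zero S h hdet a b (by omega), zero_mul]
  · simp

/-- Block factorisation of `J_{k,i}` at an anti-triangular matrix. -/
theorem aux_Jki_block {n m i : ℕ} {L : Type*} [Field L] (S : Matrix (Fin n) (Fin n) L)
    (h : ∀ r c : Fin n, (r : ℕ) + c + 1 < n → S r c = 0) (hdet : S.det ≠ 0)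
    (hk : m + 1 + i ≤ n) (hik : i < m + 1 + i) :
    ∃ ε : L, (ε = 1 ∨ ε = -1) ∧ Jki (m + 1 + i) i hk hik S = ε *
      ((Matrix.of fun r c : Fin (m + 1) =>
        S ⟨n - (m + 1) + r, by omega⟩ ⟨i + c, by omega⟩).det *
      (Matrix.of fun r c : Fin i =>
        S.adjugate ⟨n - i + r, by omega⟩ ⟨c, by omega⟩).det) := by
  unfold Jki
  obtain ⟨ε, hε, h1⟩ := aux_det_equiv (Matrix.of fun r c : Fin (m + 1 + i) =>
    if h : (r : ℕ) < m + 1 + i - i then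
      S ⟨n - (m + 1 + i - i) + (r : ℕ), by have := r.isLt; omega⟩
        ⟨(c : ℕ), by have := c.isLt; omega⟩
    else
      S.adjugate ⟨n - i + ((r : ℕ) - (m + 1 + i - i)), by have := r.isLt; omega⟩
        ⟨(c : ℕ), by have := c.isLt; omega⟩) finSumFinEquiv
      (((Equiv.sumComm _ _).trans finSumFinEquiv).trans (finCongr (Nat.add_comm i (m + 1))))
  refine ⟨ε, hε, ?_⟩
  rw [h1, ← Matrix.det_fromBlocks_zero₂₁ _ (Matrix.of fun (r : Fin (m + 1)) (c : Fin i) =>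
        S ⟨n - (m + 1) + r, by omega⟩ ⟨c, by omega⟩)]
  congr 2
  ext r c
  rcases r with r | r <;> rcases c with c | c
  · have hr := r.isLt
    simp [Nat.lt_succ_iff.1 hr, Nat.add_comm]
  · have hr := r.isLt
    simp [Nat.lt_succ_iff.1 hr]
  · have hr : ¬ (m + 1 + (r : ℕ) ≤ m) := by omega
    simp [hr]
    apply aux_adj_zero S h hdet
    simp
    omega
  · have hr : ¬ (m + 1 + (r : ℕ) ≤ m) := by omega
    simp [hr]

theorem aux_rank {n k i k' j : ℕ} (h1 : k ≤ n ∧ i < k) (h2 : k' ≤ n ∧ j < k') (hi : 0 < i)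
    (h : j = 0 ∨ k' < k ∨ (k' = k ∧ i < j)) :
    rankS n ⟨(k', j), h2⟩ < rankS n ⟨(k, i), h1⟩ := by
  unfold rankS
  simp only [hi.ne', if_false]
  split_ifs with hj
  · omega
  · rcases h with h | h | ⟨rfl, h⟩
    · exact absurd h hj
    · have h3 : (k' - 1) * (k' - 2) / 2 + (k' - 1) ≤ (k - 1) * (k - 2) / 2 := by
        obtain ⟨a, rfl⟩ : ∃ a, k' = a + 2 := ⟨k' - 2, by omega⟩
        obtain ⟨b, rfl⟩ : ∃ b, k = a + 2 + 1 + b := ⟨k - (a + 3), by omega⟩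
        have e1 : a + 2 + 1 + b - 1 = a + b + 2 := by omega
        have e2 : a + 2 + 1 + b - 2 = a + b + 1 := by omega
        have e3 : a + 2 - 1 = a + 1 := by omega
        have e4 : a + 2 - 2 = a := by omega
        rw [e1, e2, e3, e4, ← Nat.add_mul_div_right _ _ (by norm_num : 0 < 2)]
        apply Nat.div_le_div_right
        nlinarith
      omega
    · omega

/-- The matrix `π(X)`. -/
noncomputable def auxSm (K : Type*) [CommRing K] (n : ℕ) :
    Matrix (Fin n) (Fin n) (MvPolynomial (TIdx n) K) :=
  Matrix.of fun a b => if h : n ≤ (a : ℕ) + (b : ℕ) + 1 then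
      MvPolynomial.X (⟨((b : ℕ) + 1, (a : ℕ) + (b : ℕ) + 1 - n),
        by have := a.isLt; have := b.isLt; omega⟩ : TIdx n)
    else 0

theorem aux_Jki_map {n : ℕ} {R R' : Type*} [CommRing R] [CommRing R'] (f : R →+* R') (k i : ℕ)
    (hk : k ≤ n) (hik : i < k) (A : Matrix (Fin n) (Fin n) R) :
    f (Jki k i hk hik A) = Jki k i hk hik (A.map f) := by
  unfold Jki
  rw [RingHom.map_det]
  congr 1
  ext r c
  have := RingHom.map_adjugate f A
  simp only [RingHom.mapMatrix_apply] at this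
  rw [← this]
  simp only [RingHom.mapMatrix_apply, Matrix.map_apply, Matrix.of_apply]
  split_ifs <;> rfl

theorem aux_pi_gen (K : Type*) [CommRing K] (n : ℕ) :
    (genMatrix K n).map (piHom K n) = auxSm K n := by
  ext1 a b
  simp [genMatrix, piHom, auxSm]

/-- the relevant minor is non-zero -/
theorem aux_minor {n m i : ℕ} {K : Type*} [Field K] (hk : m + 1 + i ≤ n) :
    (Matrix.of fun r c : Fin m =>
        auxSm K n ⟨n - m + r, by omega⟩ ⟨i + c, by omega⟩).det ≠ 0 := by
  intro h0
  have h1 := congrArg (MvPolynomial.eval (fun t : TIdx n => if t.1.2 = i then (1 : K) else 0)) h0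
  rw [RingHom.map_det, map_zero] at h1
  obtain ⟨ε, hε, h2⟩ := aux_det_equiv (1 : Matrix (Fin m) (Fin m) K) Fin.revPerm (Equiv.refl _)
  have h3 : ((MvPolynomial.eval (fun t : TIdx n => if t.1.2 = i then (1 : K) else 0)).mapMatrix
      (Matrix.of fun r c : Fin m =>
        auxSm K n ⟨n - m + r, by omega⟩ ⟨i + c, by omega⟩)) =
      (1 : Matrix (Fin m) (Fin m) K).submatrix Fin.revPerm (Equiv.refl _) := by
    ext r c
    simp only [RingHom.mapMatrix_apply, Matrix.map_apply, Matrix.of_apply, auxSm,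
      Matrix.submatrix_apply, Matrix.one_apply, Fin.ext_iff, Fin.revPerm_apply, Fin.val_rev,
      Equiv.refl_apply]
    by_cases hh : n ≤ n - m + (r : ℕ) + (i + c) + 1
    · rw [dif_pos hh]
      refine (MvPolynomial.eval_X _).trans ?_
      congr 1
      simp only [eq_iff_iff]
      omega
    · rw [dif_neg hh, map_zero, if_neg (by omega)]
  rw [h3] at h1
  rw [h1, mul_zero, Matrix.det_one] at h2
  exact one_ne_zero h2

end helpers

/-- For every `(k,i) ∈ T` there exist rational functions `φ ≠ 0` and `ψ` in
the subfield of `K(s)` generated over `K` by the variables strictly smaller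
than `s_{k,i}`, such that `π(J_{k,i}) = φ · s_{k,i} + ψ` in `K(s)`. -/
theorem piHom_Jki_triangular {n : ℕ} {K : Type*} [Field K] [CharZero K]
    (hn : 1 ≤ n) (k i : ℕ) (hk : k ≤ n) (hik : i < k) :
    ∃ φ ψ : FractionRing (MvPolynomial (TIdx n) K),
      φ ≠ 0 ∧
      φ ∈ Subfield.closure
        (Set.range (algebraMap K (FractionRing (MvPolynomial (TIdx n) K))) ∪
          {g | ∃ t' : TIdx n, rankS n t' < rankS n ⟨(k, i), ⟨hk, hik⟩⟩ ∧
            g = algebraMap (MvPolynomial (TIdx n) K) _ (MvPolynomial.X t')}) ∧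
      ψ ∈ Subfield.closure
        (Set.range (algebraMap K (FractionRing (MvPolynomial (TIdx n) K))) ∪
          {g | ∃ t' : TIdx n, rankS n t' < rankS n ⟨(k, i), ⟨hk, hik⟩⟩ ∧
            g = algebraMap (MvPolynomial (TIdx n) K) _ (MvPolynomial.X t')}) ∧
      algebraMap (MvPolynomial (TIdx n) K) _
          (piHom K n (Jki k i hk hik (genMatrix K n))) =
        φ * algebraMap (MvPolynomial (TIdx n) K) _
              (MvPolynomial.X (⟨(k, i), ⟨hk, hik⟩⟩ : TIdx n)) + ψ := by
  classical
  set F := Subfield.closure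
        (Set.range (algebraMap K (FractionRing (MvPolynomial (TIdx n) K))) ∪
          {g | ∃ t' : TIdx n, rankS n t' < rankS n ⟨(k, i), ⟨hk, hik⟩⟩ ∧
            g = algebraMap (MvPolynomial (TIdx n) K) _ (MvPolynomial.X t')}) with hF
  have hmem : ∀ t' : TIdx n, rankS n t' < rankS n ⟨(k, i), ⟨hk, hik⟩⟩ →
      algebraMap (MvPolynomial (TIdx n) K) (FractionRing (MvPolynomial (TIdx n) K))
        (MvPolynomial.X t') ∈ F := fun t' ht =>
    Subfield.subset_closure (Or.inr ⟨t', ht, rfl⟩)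
  have hinj : Function.Injective (algebraMap (MvPolynomial (TIdx n) K)
      (FractionRing (MvPolynomial (TIdx n) K))) := IsFractionRing.injective _ _
  have hX : ∀ t' : TIdx n, algebraMap (MvPolynomial (TIdx n) K)
      (FractionRing (MvPolynomial (TIdx n) K)) (MvPolynomial.X t') ≠ 0 := fun t' h =>
    MvPolynomial.X_ne_zero t' (hinj (h.trans (map_zero _).symm))
  have hpi : piHom K n (Jki k i hk hik (genMatrix K n)) = Jki k i hk hik (auxSm K n) := by
    have := aux_Jki_map (piHom K n).toRingHom k i hk hik (genMatrix K n)
    rw [← aux_pi_gen]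
    exact this
  rw [hpi, aux_Jki_map]
  set S := (auxSm K n).map (algebraMap (MvPolynomial (TIdx n) K)
      (FractionRing (MvPolynomial (TIdx n) K))) with hS
  have hS0 : ∀ r c : Fin n, (r : ℕ) + c + 1 < n → S r c = 0 := by
    intro r c h
    simp only [hS, Matrix.map_apply, auxSm, Matrix.of_apply]
    rw [dif_neg (by omega), map_zero]
  have hS1 : ∀ (r c : Fin n) (h : n ≤ (r : ℕ) + c + 1), S r c = algebraMap (MvPolynomial (TIdx n) K)
      (FractionRing (MvPolynomial (TIdx n) K))
      (MvPolynomial.X (⟨((c : ℕ) + 1, (r : ℕ) + (c : ℕ) + 1 - n),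
        by have := r.isLt; have := c.isLt; omega⟩ : TIdx n)) := by
    intro r c h
    simp only [hS, Matrix.map_apply, auxSm, Matrix.of_apply]
    rw [dif_pos h]
  have hS2 : ∀ (r c : Fin n) (a b : ℕ) (h : b ≤ n ∧ a < b), (c : ℕ) + 1 = b →
      (r : ℕ) + c + 1 = n + a → S r c = algebraMap (MvPolynomial (TIdx n) K)
      (FractionRing (MvPolynomial (TIdx n) K))
      (MvPolynomial.X (⟨(b, a), h⟩ : TIdx n)) := by
    intro r c a b h h1 h2
    rw [hS1 r c (by omega)]
    congr 2
    apply Subtype.ext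
    simp only [Prod.mk.injEq]
    omega
  rcases Nat.eq_zero_or_pos i with rfl | hi
  · obtain ⟨m, rfl⟩ : ∃ m, k = m + 1 := ⟨k - 1, by omega⟩
    unfold Jki
    obtain ⟨ε, hε, h1⟩ := aux_det_anti (Matrix.of fun r c : Fin (m + 1) =>
      if h : (r : ℕ) < m + 1 - 0 then
        S ⟨n - (m + 1 - 0) + (r : ℕ), by have := r.isLt; omega⟩
          ⟨(c : ℕ), by have := c.isLt; omega⟩
      else
        S.adjugate ⟨n - 0 + ((r : ℕ) - (m + 1 - 0)), by have := r.isLt; omega⟩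
          ⟨(c : ℕ), by have := c.isLt; omega⟩) (by
        intro r c h
        rw [Matrix.of_apply, dif_pos (by omega)]
        apply hS0
        simp only
        omega)
    rw [h1]
    have h2 : ∀ c : Fin (m + 1), (Matrix.of fun r c : Fin (m + 1) =>
      if h : (r : ℕ) < m + 1 - 0 then
        S ⟨n - (m + 1 - 0) + (r : ℕ), by have := r.isLt; omega⟩
          ⟨(c : ℕ), by have := c.isLt; omega⟩
      else
        S.adjugate ⟨n - 0 + ((r : ℕ) - (m + 1 - 0)), by have := r.isLt; omega⟩
          ⟨(c : ℕ), by have := c.isLt; omega⟩) (Fin.rev c) c = algebraMap (MvPolynomial (TIdx n) K)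
      (FractionRing (MvPolynomial (TIdx n) K))
            (MvPolynomial.X (⟨((c : ℕ) + 1, 0), by omega⟩ : TIdx n)) := by
      intro c
      rw [Matrix.of_apply, dif_pos (by omega)]
      apply hS2 <;> simp only [Fin.val_rev]
      omega
    rw [Finset.prod_congr rfl (fun c _ => h2 c), Fin.prod_univ_castSucc]
    refine ⟨ε * ∏ c : Fin m, algebraMap (MvPolynomial (TIdx n) K)
      (FractionRing (MvPolynomial (TIdx n) K))
      (MvPolynomial.X (⟨((c : ℕ) + 1, 0), by omega⟩ : TIdx n)), 0, ?_, ?_, zero_mem _, ?_⟩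
    · exact mul_ne_zero (aux_sign_mem F hε).2 (Finset.prod_ne_zero_iff.2 fun c _ => hX _)
    · refine mul_mem (aux_sign_mem F hε).1 (prod_mem fun c _ => hmem _ ?_)
      simp [rankS]
    · simp only [Fin.val_castSucc, Fin.val_last]
      ring
  · obtain ⟨m, rfl⟩ : ∃ m, k = m + 1 + i := ⟨k - 1 - i, by omega⟩
    -- the determinant of `S`
    have hanti : ∀ c : Fin n, S (Fin.rev c) c ∈ F ∧ S (Fin.rev c) c ≠ 0 := by
      intro c
      rw [hS2 (Fin.rev c) c 0 (c + 1) (by omega) rfl (by rw [Fin.val_rev]; omega)]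
      exact ⟨hmem _ (aux_rank _ _ hi (Or.inl rfl)), hX _⟩
    obtain ⟨ε₁, hε₁, hdet⟩ := aux_det_anti S hS0
    have hdet0 : S.det ≠ 0 := by
      rw [hdet]
      exact mul_ne_zero (aux_sign_mem F hε₁).2 (Finset.prod_ne_zero_iff.2 fun c _ => (hanti c).2)
    have hdetF : S.det ∈ F := by
      rw [hdet]
      exact mul_mem (aux_sign_mem F hε₁).1 (prod_mem fun c _ => (hanti c).1)
    obtain ⟨ε, hε, h1⟩ := aux_Jki_block S hS0 hdet0 hk hik
    rw [h1]
    -- lower block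
    obtain ⟨ε₂, hε₂, hB⟩ := aux_det_anti' (Matrix.of fun r c : Fin i =>
        S.adjugate ⟨n - i + r, by omega⟩ ⟨c, by omega⟩) (by
      intro r c h
      rw [Matrix.of_apply]
      apply aux_adj_zero S hS0 hdet0
      simp only
      omega)
    have hBc : ∀ a c : Fin n, (a : ℕ) + c + 1 = n → S.adjugate a c ∈ F ∧ S.adjugate a c ≠ 0 := by
      intro a c hac
      have h2 := aux_adj_anti S hS0 hdet0 a c hac
      obtain rfl : c = Fin.rev a := by ext; rw [Fin.val_rev]; omega
      obtain ⟨h3, h4⟩ := hanti a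
      have h5 : S.adjugate a (Fin.rev a) = S.det / S (Fin.rev a) a := by
        rw [← h2]; field_simp
      rw [h5]
      exact ⟨div_mem hdetF h3, div_ne_zero hdet0 h4⟩
    set B := (Matrix.of fun r c : Fin i =>
        S.adjugate ⟨n - i + r, by omega⟩ ⟨c, by omega⟩).det with hBdef
    have hB' : B ∈ F ∧ B ≠ 0 := by
      rw [hB]
      constructor
      · refine mul_mem (aux_sign_mem F hε₂).1 (prod_mem fun c _ => (hBc _ _ ?_).1)
        simp only [Fin.val_rev]; omega
      · refine mul_ne_zero (aux_sign_mem F hε₂).2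
          (Finset.prod_ne_zero_iff.2 fun c _ => (hBc _ _ ?_).2)
        simp only [Fin.val_rev]; omega
    -- upper block
    have hent : ∀ (r c : Fin n), (c : ℕ) + 1 ≤ m + 1 + i →
        ((c : ℕ) + 1 = m + 1 + i → n + i < (r : ℕ) + c + 1) → S r c ∈ F := by
      intro r c h2 h3
      by_cases h4 : n ≤ (r : ℕ) + c + 1
      · rw [hS1 r c h4]
        refine hmem _ (aux_rank _ _ hi ?_)
        omega
      · rw [hS0 r c (by omega)]
        exact zero_mem _
    have hmin : ((Matrix.of fun r c : Fin m =>
        S ⟨n - m + r, by omega⟩ ⟨i + c, by omega⟩).det ≠ 0) := by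
      have h2 := aux_minor (K := K) hk
      intro h3
      apply h2
      apply hinj
      rw [RingHom.map_det, map_zero, ← h3]
      rfl
    rw [Matrix.det_succ_row_zero, Fin.sum_univ_castSucc]
    have hlast : (Matrix.of fun r c : Fin (m + 1) =>
        S ⟨n - (m + 1) + r, by omega⟩ ⟨i + c, by omega⟩) 0 (Fin.last m) = algebraMap (MvPolynomial (TIdx n) K)
      (FractionRing (MvPolynomial (TIdx n) K))
          (MvPolynomial.X (⟨(m + 1 + i, i), ⟨hk, hik⟩⟩ : TIdx n)) := by
      rw [Matrix.of_apply]
      apply hS2 <;> simp <;> omega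
    have hsub : (Matrix.of fun r c : Fin (m + 1) =>
        S ⟨n - (m + 1) + r, by omega⟩ ⟨i + c, by omega⟩).submatrix Fin.succ
          (Fin.last m).succAbove = (Matrix.of fun r c : Fin m =>
        S ⟨n - m + r, by omega⟩ ⟨i + c, by omega⟩) := by
      ext r c
      simp only [Matrix.submatrix_apply, Matrix.of_apply, Fin.succAbove_last, Fin.val_castSucc,
        Fin.val_succ]
      congr 2
      omega
    rw [hlast, hsub]
    set P := (Matrix.of fun r c : Fin m =>
        S ⟨n - m + r, by omega⟩ ⟨i + c, by omega⟩) with hP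
    refine ⟨ε * B * ((-1) ^ ((Fin.last m : Fin (m + 1)) : ℕ) * P.det), ε * B *
      ∑ j : Fin m, (-1) ^ ((Fin.castSucc j : Fin (m + 1)) : ℕ) *
        (Matrix.of fun r c : Fin (m + 1) =>
        S ⟨n - (m + 1) + r, by omega⟩ ⟨i + c, by omega⟩) 0 (Fin.castSucc j) *
        ((Matrix.of fun r c : Fin (m + 1) =>
        S ⟨n - (m + 1) + r, by omega⟩ ⟨i + c, by omega⟩).submatrix Fin.succ
          (Fin.castSucc j).succAbove).det, ?_, ?_, ?_, ?_⟩
    · exact mul_ne_zero (mul_ne_zero (aux_sign_mem F hε).2 hB'.2)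
        (mul_ne_zero (pow_ne_zero _ (by simp)) hmin)
    · refine mul_mem (mul_mem (aux_sign_mem F hε).1 hB'.1)
        (mul_mem (pow_mem (neg_mem (one_mem _)) _) (aux_det_mem F _ fun r c => ?_))
      rw [hP, Matrix.of_apply]
      apply hent <;> simp only <;> omega
    · refine mul_mem (mul_mem (aux_sign_mem F hε).1 hB'.1) (sum_mem fun j _ =>
        mul_mem (mul_mem (pow_mem (neg_mem (one_mem _)) _) ?_) (aux_det_mem F _ fun r c => ?_))
      · rw [Matrix.of_apply]
        apply hent <;> simp only [Fin.val_castSucc] <;> omega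
      · rw [Matrix.submatrix_apply, Matrix.of_apply]
        apply hent <;> simp only [Fin.val_succ] <;> omega
    · ring
end

section
/- For every B ∈ L: (a) the adjugate B* satisfies (B*)_{a,c} = 0 whenever a + c > n+1; (b) for each 1 ≤ i ≤ n−1, the determinant of the i×i submatrix C of B* formed by its last i rows and first i columns equals ε·∏_{j=1}^{n−i} b_{j,0}^{i} · ∏_{j=n−i+1}^{n} b_{j,0}^{i−1} for a sign ε ∈ {1,−1} depending only on n and i; in particular det(C) ≠ 0. -/
open Matrix

/-- `B` belongs to `L`: all entries strictly above the anti-diagonal vanish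
(`B_{a,c} = 0` whenever `a + c ≤ n` in 1-indexing) and all anti-diagonal
entries `B_{n+1-c,c}` are nonzero. -/
def MemL {n : ℕ} {K : Type*} [CommRing K] (B : Matrix (Fin n) (Fin n) K) : Prop :=
  (∀ a c : Fin n, (a : ℕ) + (c : ℕ) + 2 ≤ n → B a c = 0) ∧
    ∀ c : Fin n, B ⟨n - 1 - (c : ℕ), by have := c.isLt; omega⟩ c ≠ 0

/-- The row-reversed matrix. -/
def revT {n : ℕ} {K : Type*} (B : Matrix (Fin n) (Fin n) K) : Matrix (Fin n) (Fin n) K :=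
  B.submatrix Fin.revPerm id

lemma rev_eq {n : ℕ} (c : Fin n) (h : n - 1 - (c : ℕ) < n) :
    (⟨n - 1 - (c : ℕ), h⟩ : Fin n) = Fin.rev c := by
  ext; simp [Fin.val_rev]; omega

lemma revT_tri {n : ℕ} {K : Type*} [Field K] {B : Matrix (Fin n) (Fin n) K} (hB : MemL B) :
    (revT B).BlockTriangular id := by
  intro a c h
  simp only [id] at h
  apply hB.1
  simp [Fin.val_rev]
  have := a.isLt
  have : (c : ℕ) < a := h
  omega

lemma revT_diag {n : ℕ} {K : Type*} [Field K] {B : Matrix (Fin n) (Fin n) K} (hB : MemL B)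
    (c : Fin n) : revT B c c ≠ 0 := by
  have := hB.2 c
  rw [rev_eq] at this
  exact this

lemma revT_det {n : ℕ} {K : Type*} [Field K] {B : Matrix (Fin n) (Fin n) K} (hB : MemL B) :
    (revT B).det = ∏ j, revT B j j := Matrix.det_of_isUpperTriangular (revT_tri hB)

lemma revT_unit {n : ℕ} {K : Type*} [Field K] {B : Matrix (Fin n) (Fin n) K} (hB : MemL B) :
    IsUnit (revT B).det := by
  rw [revT_det hB, isUnit_iff_ne_zero]
  exact Finset.prod_ne_zero_iff.2 fun j _ => revT_diag hB j

lemma revT_inv_tri {n : ℕ} {K : Type*} [Field K] {B : Matrix (Fin n) (Fin n) K} (hB : MemL B) :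
    (revT B)⁻¹.BlockTriangular id := by
  haveI := Matrix.invertibleOfIsUnitDet _ (revT_unit hB)
  exact Matrix.blockTriangular_inv_of_blockTriangular (revT_tri hB)

lemma revT_inv_diag {n : ℕ} {K : Type*} [Field K] {B : Matrix (Fin n) (Fin n) K} (hB : MemL B)
    (j : Fin n) : (revT B)⁻¹ j j = (revT B j j)⁻¹ := by
  have h : ((revT B) * (revT B)⁻¹) j j = 1 := by
    rw [Matrix.mul_nonsing_inv _ (revT_unit hB)]; simp
  rw [Matrix.mul_apply, Finset.sum_eq_single j] at h
  · exact eq_inv_of_mul_eq_one_right h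
  · intro k _ hk
    rcases lt_or_gt_of_ne hk with h1 | h1
    · rw [revT_tri hB (show id k < id j from h1), zero_mul]
    · rw [revT_inv_tri hB (show id j < id k from h1), mul_zero]
  · simp

/-- The sign of the reversal as a field element. -/
def rsgn (K : Type*) [Field K] (n : ℕ) : K := ((Equiv.Perm.sign (Fin.revPerm (n := n)) : ℤ) : K)

lemma rsgn_cases (K : Type*) [Field K] (n : ℕ) : rsgn K n = 1 ∨ rsgn K n = -1 := by
  unfold rsgn
  rcases Int.units_eq_one_or (Equiv.Perm.sign (Fin.revPerm (n := n))) with h | h <;> simp [h]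

lemma rsgn_sq (K : Type*) [Field K] (n : ℕ) : rsgn K n * rsgn K n = 1 := by
  rcases rsgn_cases K n with h | h <;> simp [h]

lemma adj_eq {n : ℕ} {K : Type*} [Field K] {B : Matrix (Fin n) (Fin n) K} (hB : MemL B)
    (a c : Fin n) :
    B.adjugate a c = rsgn K n * (revT B).det * (revT B)⁻¹ a (Fin.rev c) := by
  have h1 : (revT B).det = rsgn K n * B.det := Matrix.det_permute _ _
  have hu : IsUnit B.det := by
    have := revT_unit hB
    rw [h1] at this
    exact (IsUnit.mul_iff.1 this).2
  have h2 : (revT B)⁻¹ = B⁻¹.submatrix id Fin.revPerm := by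
    apply Matrix.inv_eq_right_inv
    ext i j
    have : (B * B⁻¹) (Fin.rev i) (Fin.rev j) = (1 : Matrix (Fin n) (Fin n) K) i j := by
      rw [Matrix.mul_nonsing_inv _ hu]; simp [Matrix.one_apply]
    rw [← this]; simp [revT, Matrix.mul_apply]
  rw [h2, h1, ← mul_assoc, rsgn_sq, one_mul, Matrix.inv_def]
  simp [Ring.inverse_eq_inv']
  rw [mul_inv_cancel_left₀ hu.ne_zero]

lemma prod_identity {m i : ℕ} (hi : 1 ≤ i) {K : Type*} [Field K] (t : Fin (m + i) → K)
    (ht : ∀ j, t j ≠ 0) :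
    (∏ j, t j) ^ i * ∏ r : Fin i, (t (Fin.natAdd m r))⁻¹ =
      ∏ j, t j ^ (if (j : ℕ) < m then i else i - 1) := by
  rw [Fin.prod_univ_add, Fin.prod_univ_add, mul_pow, mul_assoc, ← Finset.prod_pow,
    ← Finset.prod_pow, ← Finset.prod_mul_distrib]
  congr 1
  · simp
  · apply Finset.prod_congr rfl
    intro r _
    simp
    rw [pow_sub₀ _ (ht _) hi, pow_one]

/-- For every `B ∈ L`:
(a) the adjugate `B*` satisfies `(B*)_{a,c} = 0` whenever `a + c > n + 1`
(in 1-indexing);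
(b) for each `1 ≤ i ≤ n-1`, the determinant of the `i × i` submatrix `C` of
`B*` formed by its last `i` rows and first `i` columns equals
`ε · ∏_{j=1}^{n-i} b_{j,0}^i · ∏_{j=n-i+1}^{n} b_{j,0}^{i-1}` for a sign
`ε ∈ {1, -1}` depending only on `n` and `i` (here `b_{j,0} = B_{n+1-j,j}` are
the anti-diagonal entries); in particular `det C ≠ 0`. -/
theorem adjugate_on_L {n : ℕ} {K : Type*} [Field K] [CharZero K] (hn : 1 ≤ n) :
    (∀ B : Matrix (Fin n) (Fin n) K, MemL B →
      ∀ a c : Fin n, n + 1 < (a : ℕ) + (c : ℕ) + 2 → B.adjugate a c = 0) ∧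
    ∀ i : ℕ, ∀ _hi1 : 1 ≤ i, ∀ _hi2 : i ≤ n - 1,
      ∃ ε : K, (ε = 1 ∨ ε = -1) ∧
        ∀ B : Matrix (Fin n) (Fin n) K, MemL B →
          Matrix.det (Matrix.of fun r c : Fin i =>
              B.adjugate ⟨n - i + (r : ℕ), by have := r.isLt; omega⟩
                ⟨(c : ℕ), by have := c.isLt; omega⟩) =
            ε * ∏ j : Fin n,
              (B ⟨n - 1 - (j : ℕ), by have := j.isLt; omega⟩ j) ^
                (if (j : ℕ) < n - i then i else i - 1) ∧
          Matrix.det (Matrix.of fun r c : Fin i =>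
              B.adjugate ⟨n - i + (r : ℕ), by have := r.isLt; omega⟩
                ⟨(c : ℕ), by have := c.isLt; omega⟩) ≠ 0 := by
  refine ⟨?_, ?_⟩
  · intro B hB a c h
    rw [adj_eq hB, revT_inv_tri hB, mul_zero]
    show (Fin.rev c) < a
    rw [Fin.lt_def, Fin.val_rev]
    have := c.isLt
    omega
  · intro i hi1 hi2
    obtain ⟨m, rfl⟩ : ∃ m, n = m + i := ⟨n - i, by omega⟩
    refine ⟨rsgn K i * rsgn K (m + i) ^ i, ?_, ?_⟩
    · rcases rsgn_cases K i with h | h <;> rcases rsgn_cases K (m + i) with h' | h' <;>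
        rcases neg_one_pow_eq_or K i with h'' | h'' <;> simp [h, h', h'']
    intro B hB
    set C := Matrix.of fun r c : Fin i =>
              B.adjugate ⟨m + i - i + (r : ℕ), by have := r.isLt; omega⟩
                ⟨(c : ℕ), by have := c.isLt; omega⟩ with hC
    have hD : ∀ r c : Fin i, C r (Fin.rev c) = rsgn K (m + i) * (revT B).det *
        (revT B)⁻¹ (Fin.natAdd m r) (Fin.natAdd m c) := by
      intro r c
      rw [hC, Matrix.of_apply, adj_eq hB]
      have e1 : (⟨m + i - i + (r : ℕ), by have := r.isLt; omega⟩ : Fin (m + i)) =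
          Fin.natAdd m r := by
        ext; simp
      have e2 : Fin.rev (⟨(Fin.rev c : Fin i), by have := (Fin.rev c).isLt; omega⟩ : Fin (m + i)) =
          Fin.natAdd m c := by
        ext
        simp [Fin.val_rev]
        have := c.isLt
        omega
      rw [e1, e2]
    have hdet : (C.submatrix id Fin.revPerm).det = rsgn K i * C.det := Matrix.det_permute' _ _
    have htri : (C.submatrix id Fin.revPerm).BlockTriangular id := by
      intro r c h
      simp only [id] at h
      show C r (Fin.rev c) = 0
      rw [hD, revT_inv_tri hB, mul_zero]
      show Fin.natAdd m c < Fin.natAdd m r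
      rw [Fin.lt_def]
      simpa using h
    have key : C.det = rsgn K i * rsgn K (m + i) ^ i *
        ∏ j, revT B j j ^ (if (j : ℕ) < m then i else i - 1) := by
      rw [← prod_identity hi1 _ (revT_diag hB), ← revT_det hB]
      have h1 : C.det = rsgn K i * (C.submatrix id Fin.revPerm).det := by
        rw [hdet, ← mul_assoc, rsgn_sq, one_mul]
      rw [h1, Matrix.det_of_isUpperTriangular htri]
      have h2 : ∀ r : Fin i, (C.submatrix id Fin.revPerm) r r = rsgn K (m + i) * (revT B).det *
          (revT B (Fin.natAdd m r) (Fin.natAdd m r))⁻¹ := by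
        intro r
        rw [← revT_inv_diag hB, ← hD]
        rfl
      simp only [h2, Finset.prod_mul_distrib, Finset.prod_const, Finset.card_univ,
        Fintype.card_fin]
      ring
    constructor
    · rw [key]
      congr 1
      apply Finset.prod_congr rfl
      intro j _
      rw [rev_eq, Nat.add_sub_cancel]
      rfl
    · rw [key]
      refine mul_ne_zero (mul_ne_zero ?_ (pow_ne_zero _ ?_))
        (Finset.prod_ne_zero_iff.2 fun j _ => pow_ne_zero _ (revT_diag hB j))
      · rcases rsgn_cases K i with h | h <;> simp [h]
      · rcases rsgn_cases K (m + i) with h | h <;> simp [h]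
end

section
/- The rational function field K(s) is generated over K, as a field, by the family {π(J_{k,i}) : (k,i) ∈ T}: the smallest subfield of K(s) containing K and all π(J_{k,i}) is K(s) itself. -/
open Matrix MvPolynomial

namespace JGen

/-- Solid minor on the last `m` rows and columns `i, …, i+m-1`. -/
def mnr {L : Type*} [CommRing L] (n : ℕ) (s : ℕ → ℕ → L) (m i : ℕ) : L :=
  Matrix.det (Matrix.of fun r c : Fin m => s (n - m + (r : ℕ)) (i + (c : ℕ)))

theorem det_mem {L : Type*} [Field L] (F : Subfield L) {m : ℕ} (M : Matrix (Fin m) (Fin m) L)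
    (h : ∀ i j, M i j ∈ F) : M.det ∈ F := by
  rw [Matrix.det_apply]
  refine sum_mem fun σ _ => ?_
  rw [Units.smul_def]
  exact zsmul_mem (prod_mem fun i _ => h _ _) _

theorem mem_of_mul_mem {L : Type*} [Field L] (F : Subfield L) {x y : L} (hy : y ∈ F) (h0 : y ≠ 0)
    (h : x * y ∈ F) : x ∈ F := by
  have := F.mul_mem h (F.inv_mem hy)
  rwa [mul_assoc, mul_inv_cancel₀ h0, mul_one] at this

theorem mnr_succ {L : Type*} [Field L] (F : Subfield L) (n : ℕ) (s : ℕ → ℕ → L) (m i : ℕ)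
    (hm : i + m + 1 ≤ n) (h1 : mnr n s (m+1) i ∈ F) (h2 : mnr n s m i ∈ F)
    (h0 : mnr n s m i ≠ 0)
    (h : ∀ c : Fin m, s (n - (m+1)) (i + c) *
      (Matrix.of fun r d : Fin m => s (n - (m+1) + (r + 1)) (i + (c.castSucc.succAbove d : ℕ))).det
        ∈ F) :
    s (n - (m+1)) (i + m) ∈ F := by
  have e : ∀ c : Fin (m+1), ((Matrix.of fun r c : Fin (m+1) =>
      s (n - (m+1) + (r : ℕ)) (i + (c : ℕ))).submatrix Fin.succ c.succAbove) =
      Matrix.of fun r d : Fin m => s (n - (m+1) + (r + 1)) (i + (c.succAbove d : ℕ)) := by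
    intro c; ext r d; simp
  unfold mnr at h1
  rw [Matrix.det_succ_row_zero, Fin.sum_univ_castSucc] at h1
  simp only [e] at h1
  have hA := (F.sub_mem h1 (sum_mem (t := Finset.univ) (f := fun c : Fin m => (-1 : L) ^ (c : ℕ) *
    (s (n - (m+1)) (i + c) *
      (Matrix.of fun r d : Fin m => s (n - (m+1) + (r + 1)) (i + (c.castSucc.succAbove d : ℕ))).det))
      fun c _ => F.mul_mem (F.pow_mem (F.neg_mem F.one_mem) _) (h c)))
  have e2 : (Matrix.of fun r d : Fin m => s (n - (m+1) + (r + 1)) (i + ((Fin.last m).succAbove d : ℕ))).det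
      = mnr n s m i := by
    unfold mnr; congr 1; ext r d
    simp only [Matrix.of_apply, Fin.succAbove_last, Fin.val_castSucc]
    congr 1; omega
  rw [e2] at hA
  simp only [Matrix.of_apply, Fin.val_zero, add_zero, Fin.val_castSucc, Fin.val_last, mul_assoc,
    add_sub_cancel_left] at hA
  have h3 := F.mul_mem (F.pow_mem (F.neg_mem F.one_mem) m) hA
  rw [← mul_assoc, ← pow_add, ← two_mul, pow_mul] at h3
  simp only [even_two, Even.neg_pow, one_pow, one_mul] at h3
  exact mem_of_mul_mem F h2 h0 h3

/-- Solid minors determine all entries. -/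
theorem entries_mem {L : Type*} [Field L] (F : Subfield L) (n : ℕ) (s : ℕ → ℕ → L)
    (hs : ∀ a b, a + b + 1 < n → s a b = 0)
    (h1 : ∀ m i, i + m ≤ n → mnr n s m i ∈ F)
    (h0 : ∀ m i, i + m ≤ n → mnr n s m i ≠ 0) :
    ∀ b, b < n → ∀ m, m < n → s (n - (m+1)) b ∈ F := by
  intro b
  induction b using Nat.strong_induction_on with
  | _ b ihb =>
  intro hb m
  induction m using Nat.strong_induction_on with
  | _ m ihm =>
  intro hm
  by_cases hmb : b < m
  · rw [hs _ _ (by omega)]; exact F.zero_mem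
  have key := mnr_succ F n s m (b - m) (by omega) (h1 _ _ (by omega)) (h1 _ _ (by omega))
    (h0 _ _ (by omega)) ?_
  · rwa [show b - m + m = b by omega] at key
  intro c
  refine F.mul_mem (ihb _ (by omega) (by omega) m hm) (det_mem F _ fun r d => ?_)
  simp only [Matrix.of_apply]
  have hd := (c.castSucc.succAbove d).isLt
  have hr := r.isLt
  have e : n - (m+1) + ((r : ℕ) + 1) = n - ((m - 1 - r) + 1) := by omega
  rw [e]
  by_cases hlt : b - m + (c.castSucc.succAbove d : ℕ) < b
  · exact ihb _ hlt (by omega) _ (by omega)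
  · rw [show b - m + (c.castSucc.succAbove d : ℕ) = b by omega]
    exact ihm _ (by omega) (by omega)

theorem antidiag_mem {L : Type*} [Field L] (F : Subfield L) (n : ℕ) (s : ℕ → ℕ → L)
    (hs : ∀ a b, a + b + 1 < n → s a b = 0)
    (h1 : ∀ m, m ≤ n → mnr n s m 0 ∈ F)
    (h0 : ∀ m, m ≤ n → mnr n s m 0 ≠ 0) (b : ℕ) (hb : b < n) : s (n - (b+1)) b ∈ F := by
  have key := mnr_succ F n s b 0 (by omega) (h1 _ (by omega)) (h1 _ (by omega))
    (h0 _ (by omega)) ?_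
  · simpa using key
  intro c
  rw [hs _ _ (by omega), zero_mul]
  exact F.zero_mem

/-- facts about the adjugate of an anti-triangular matrix -/
theorem adj_facts {L : Type*} [Field L] {n : ℕ} (S : Matrix (Fin n) (Fin n) L)
    (hS : ∀ a b : Fin n, (a : ℕ) + b + 1 < n → S a b = 0) (hd : S.det ≠ 0) :
    (∀ a b : Fin n, n ≤ (a : ℕ) + b → S.adjugate a b = 0) ∧
    (∀ a : Fin n, S.adjugate a a.rev * S a.rev a = S.det) := by
  set U := S.submatrix Fin.revPerm id with hU
  have hUt : U.BlockTriangular id := by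
    intro a b hab
    simp only [id] at hab
    apply hS
    simp only [Fin.revPerm_apply, id, Fin.val_rev]
    omega
  have hUd : IsUnit U.det := by
    rw [hU, Matrix.det_permute]
    rcases Int.units_eq_one_or (Equiv.Perm.sign (Fin.revPerm : Equiv.Perm (Fin n))) with h | h <;>
      rw [h] <;> simp [hd]
  have hUi : U⁻¹ = S⁻¹.submatrix id Fin.revPerm := by
    have := Matrix.inv_submatrix_equiv S Fin.revPerm (Equiv.refl _)
    exact this
  let _ : Invertible U := Matrix.invertibleOfIsUnitDet _ hUd
  have hUit : (U⁻¹).BlockTriangular id := Matrix.blockTriangular_inv_of_blockTriangular hUt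
  have hadj : ∀ a b, S.adjugate a b = S.det * U⁻¹ a b.rev := by
    intro a b
    rw [hUi, Matrix.inv_def]
    simp [hd]
  constructor
  · intro a b hab
    rw [hadj, hUit, mul_zero]
    simp only [id, Fin.lt_def, Fin.val_rev]
    omega
  · intro a
    have h1 : (U⁻¹ * U) a a = 1 := by
      rw [Matrix.nonsing_inv_mul _ hUd]; simp
    rw [Matrix.mul_apply, Finset.sum_eq_single a] at h1
    · rw [hadj, mul_assoc]
      have : S a.rev a = U a a := by simp [hU]
      rw [this, Fin.rev_rev, h1, mul_one]
    · intro j _ hj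
      rcases lt_or_gt_of_ne hj with h | h
      · rw [hUit h, zero_mul]
      · rw [hUt h, mul_zero]
    · simp

/-- The adjugate block. -/
def dblk {L : Type*} [CommRing L] {n : ℕ} (S : Matrix (Fin n) (Fin n) L) (i : ℕ) (hi : i ≤ n) :
    Matrix (Fin i) (Fin i) L :=
  Matrix.of fun r c => S.adjugate ⟨n - i + r, by omega⟩ ⟨c, by omega⟩

theorem dblk_det {L : Type*} [Field L] (F : Subfield L) {n : ℕ} (S : Matrix (Fin n) (Fin n) L)
    (hS : ∀ a b : Fin n, (a : ℕ) + b + 1 < n → S a b = 0) (hd : S.det ≠ 0) (hdF : S.det ∈ F)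
    (hF : ∀ a : Fin n, S a.rev a ∈ F) (i : ℕ) (hi : i ≤ n) :
    (dblk S i hi).det ∈ F ∧ (dblk S i hi).det ≠ 0 := by
  obtain ⟨hz, ha⟩ := adj_facts S hS hd
  have h1 : ((dblk S i hi).submatrix id Fin.revPerm).det =
      ∏ r, ((dblk S i hi).submatrix id Fin.revPerm) r r := by
    apply Matrix.det_of_isUpperTriangular
    intro r c hrc
    simp only [id, Fin.lt_def] at hrc
    apply hz
    simp only [Fin.revPerm_apply, Fin.val_rev, id]
    omega
  have h2 : ∀ r : Fin i, ((dblk S i hi).submatrix id Fin.revPerm) r r ∈ F ∧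
      ((dblk S i hi).submatrix id Fin.revPerm) r r ≠ 0 := by
    intro r
    have e : ((dblk S i hi).submatrix id Fin.revPerm) r r =
        S.adjugate ⟨n - i + r, by omega⟩ (Fin.rev ⟨n - i + r, by omega⟩) := by
      simp only [dblk, Matrix.submatrix_apply, Matrix.of_apply, id, Fin.revPerm_apply]
      congr 1
      ext
      simp only [Fin.val_rev]
      omega
    rw [e]
    have h3 := ha ⟨n - i + r, by omega⟩
    have hne : S (Fin.rev ⟨n - i + r, by omega⟩) ⟨n - i + r, by omega⟩ ≠ 0 := by
      intro h; rw [h, mul_zero] at h3; exact hd h3.symm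
    constructor
    · exact mem_of_mul_mem F (hF _) hne (h3 ▸ hdF)
    · intro h; rw [h, zero_mul] at h3; exact hd h3.symm
  rw [Matrix.det_permute'] at h1
  have h4 : (∏ r, ((dblk S i hi).submatrix id Fin.revPerm) r r) ∈ F :=
    prod_mem fun r _ => (h2 r).1
  have h5 : (∏ r, ((dblk S i hi).submatrix id Fin.revPerm) r r) ≠ 0 :=
    Finset.prod_ne_zero_iff.2 fun r _ => (h2 r).2
  rw [← h1] at h4 h5
  rcases Int.units_eq_one_or (Equiv.Perm.sign (Fin.revPerm : Equiv.Perm (Fin i))) with h | h <;>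
    rw [h] at h4 h5 <;> simp at h4 h5 <;> exact ⟨h4, h5⟩

/-- extend a matrix by zero to natural number indices -/
def ext0 {L : Type*} [CommRing L] {n : ℕ} (S : Matrix (Fin n) (Fin n) L) (a b : ℕ) : L :=
  if h : a < n ∧ b < n then S ⟨a, h.1⟩ ⟨b, h.2⟩ else 0

theorem Jki_eq {L : Type*} [Field L] {n : ℕ} (S : Matrix (Fin n) (Fin n) L)
    (hz : ∀ a b : Fin n, n ≤ (a : ℕ) + b → S.adjugate a b = 0)
    (m i : ℕ) (hm : 0 < m) (hk : i + m ≤ n) :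
    Jki (i + m) i hk (by omega) S = mnr n (ext0 S) m i * (dblk S i (by omega)).det ∨
    Jki (i + m) i hk (by omega) S = - (mnr n (ext0 S) m i * (dblk S i (by omega)).det) := by
  let e1 : Fin m ⊕ Fin i ≃ Fin (i + m) := finSumFinEquiv.trans (finCongr (by omega))
  let e2 : Fin m ⊕ Fin i ≃ Fin (i + m) := (Equiv.sumComm _ _).trans finSumFinEquiv
  unfold Jki
  generalize hM : (Matrix.of fun r c : Fin (i + m) => _ : Matrix (Fin (i+m)) (Fin (i+m)) L) = M
  have h1 : M.submatrix e1 e2 = (M.submatrix id (e1.symm.trans e2)).submatrix e1 e1 := by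
    ext a b; simp
  have h2 : M.submatrix e1 e2 = Matrix.fromBlocks
      (Matrix.of fun r c : Fin m => ext0 S (n - m + (r : ℕ)) (i + (c : ℕ)))
      (Matrix.of fun r c => M (e1 (Sum.inl r)) (e2 (Sum.inr c))) 0 (dblk S i (by omega)) := by
    ext a b
    rcases a with a | a <;> rcases b with b | b
    · have ha := a.isLt
      have hb := b.isLt
      subst hM
      have hc : n - m + (a : ℕ) < n ∧ i + (b : ℕ) < n := by omega
      simp [e1, e2, ext0, hc]
    · rfl
    · have ha := a.isLt
      have hb := b.isLt
      subst hM
      simp [e1, e2]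
      apply hz
      simp
      omega
    · have ha := a.isLt
      have hb := b.isLt
      subst hM
      simp [e1, e2, dblk]
  have h3 : (M.submatrix e1 e2).det = mnr n (ext0 S) m i * (dblk S i (by omega)).det := by
    rw [h2, Matrix.det_fromBlocks_zero₂₁]; rfl
  rw [h1, Matrix.det_submatrix_equiv_self, Matrix.det_permute'] at h3
  rw [← h3]
  rcases Int.units_eq_one_or (Equiv.Perm.sign (e1.symm.trans e2)) with h | h <;> rw [h] <;> simp

theorem main_field {L : Type*} [Field L] (F : Subfield L) {n : ℕ} (S : Matrix (Fin n) (Fin n) L)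
    (hS : ∀ a b : Fin n, (a : ℕ) + b + 1 < n → S a b = 0)
    (h0 : ∀ m i, i + m ≤ n → mnr n (ext0 S) m i ≠ 0)
    (hJ : ∀ k i (hk : k ≤ n) (hi : i < k), Jki k i hk hi S ∈ F) (a b : Fin n) : S a b ∈ F := by
  have hs : ∀ a b, a + b + 1 < n → ext0 S a b = 0 := by
    intro a b h
    unfold ext0
    split_ifs with h'
    · exact hS _ _ h
    · rfl
  have hdet : mnr n (ext0 S) n 0 = S.det := by
    unfold mnr; congr 1; ext a b; simp [ext0]
  have hd : S.det ≠ 0 := hdet ▸ h0 n 0 (by omega)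
  obtain ⟨hz, -⟩ := adj_facts S hS hd
  have hJ' : ∀ m i (hk : i + m ≤ n), 0 < m →
      mnr n (ext0 S) m i * (dblk S i (by omega)).det ∈ F := by
    intro m i hk hm
    have h := hJ (i + m) i hk (by omega)
    rcases Jki_eq S hz m i hm hk with h' | h' <;> rw [h'] at h
    · exact h
    · exact neg_mem_iff.1 h
  have hm0 : ∀ i, mnr n (ext0 S) 0 i ∈ F := by
    intro i; simp [mnr]
  have hmi0 : ∀ m, m ≤ n → mnr n (ext0 S) m 0 ∈ F := by
    intro m hm
    rcases Nat.eq_zero_or_pos m with rfl | hp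
    · exact hm0 0
    · simpa using hJ' m 0 (by omega) hp
  have hF : ∀ a : Fin n, S a.rev a ∈ F := by
    intro a
    have := antidiag_mem F n (ext0 S) hs hmi0 (fun m hm => h0 m 0 (by omega)) a a.isLt
    have hc : n - ((a : ℕ) + 1) < n := by omega
    simp only [ext0, hc, a.isLt, and_self, dite_true] at this
    exact this
  have hD := dblk_det F S hS hd (hdet ▸ hmi0 n le_rfl) hF
  have hall : ∀ m i, i + m ≤ n → mnr n (ext0 S) m i ∈ F := by
    intro m i hk
    rcases Nat.eq_zero_or_pos m with rfl | hp
    · exact hm0 i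
    · exact mem_of_mul_mem F (hD i (by omega)).1 (hD i (by omega)).2 (hJ' m i hk hp)
  have := entries_mem F n (ext0 S) hs hall h0 b b.isLt (n - 1 - a) (by omega)
  rw [show n - (n - 1 - (a : ℕ) + 1) = a by omega] at this
  simpa [ext0] using this

theorem Jki_map {R R' : Type*} [CommRing R] [CommRing R'] (f : R →+* R') {n : ℕ} (k i : ℕ)
    (hk : k ≤ n) (hi : i < k) (A : Matrix (Fin n) (Fin n) R) :
    f (Jki k i hk hi A) = Jki k i hk hi (A.map f) := by
  unfold Jki
  rw [RingHom.map_det]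
  congr 1
  have h := RingHom.map_adjugate f A
  ext r c
  simp only [RingHom.mapMatrix_apply, Matrix.map_apply, Matrix.of_apply] at h ⊢
  split_ifs
  · rfl
  · rw [← h]; rfl

theorem mnr_map {R R' : Type*} [CommRing R] [CommRing R'] (f : R →+* R') {n : ℕ} (m i : ℕ)
    (A : Matrix (Fin n) (Fin n) R) :
    f (mnr n (ext0 A) m i) = mnr n (ext0 (A.map f)) m i := by
  unfold mnr
  rw [RingHom.map_det]
  congr 1
  ext r c
  simp only [RingHom.mapMatrix_apply, Matrix.map_apply, Matrix.of_apply, ext0]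
  split_ifs
  · rfl
  · simp

/-- The image of the generic matrix. -/
noncomputable def sMat (K : Type*) [CommRing K] (n : ℕ) :
    Matrix (Fin n) (Fin n) (MvPolynomial (TIdx n) K) :=
  (genMatrix K n).map (piHom K n)

/-- Constructor for indices. -/
def tmk {n : ℕ} (k i : ℕ) (hk : k ≤ n) (hi : i < k) : TIdx n := ⟨(k, i), hk, hi⟩

theorem sMat_zero (K : Type*) [CommRing K] (n : ℕ) (a b : Fin n) (h : (a : ℕ) + b + 1 < n) :
    sMat K n a b = 0 := by
  have e : sMat K n a b = piHom K n (MvPolynomial.X (a, b)) := rfl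
  rw [e, piHom, MvPolynomial.aeval_X]
  exact dif_neg (by simp only; omega)

theorem sMat_X (K : Type*) [CommRing K] (n : ℕ) (a b : Fin n) (k i : ℕ) (hk : k ≤ n) (hi : i < k)
    (h1 : (b : ℕ) + 1 = k) (h2 : (a : ℕ) + b + 1 = n + i) :
    sMat K n a b = MvPolynomial.X (tmk k i hk hi) := by
  have e : sMat K n a b = piHom K n (MvPolynomial.X (a, b)) := rfl
  rw [e, piHom, MvPolynomial.aeval_X]
  obtain rfl : i = (a : ℕ) + b + 1 - n := by omega
  subst h1
  exact dif_pos (by simp only; omega)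

theorem mnr_ne (K : Type*) [Field K] (n m i : ℕ) (h : i + m ≤ n) :
    mnr n (ext0 (sMat K n)) m i ≠ 0 := by
  intro h0
  let φ : MvPolynomial (TIdx n) K →ₐ[K] K :=
    MvPolynomial.aeval fun t => if t.1.2 = i then 1 else 0
  have h1 := mnr_map (φ : MvPolynomial (TIdx n) K →+* K) m i (sMat K n)
  rw [h0, map_zero] at h1
  have h2 : mnr n (ext0 ((sMat K n).map (φ : MvPolynomial (TIdx n) K →+* K))) m i =
      ((1 : Matrix (Fin m) (Fin m) K).submatrix Fin.revPerm id).det := by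
    unfold mnr
    congr 1
    ext r c
    have hr := r.isLt
    have hc := c.isLt
    have hh : n - m + (r : ℕ) < n ∧ i + (c : ℕ) < n := by omega
    simp only [ext0, Matrix.of_apply, hh, and_self, dite_true, Matrix.map_apply,
      Matrix.submatrix_apply, Matrix.one_apply, Fin.revPerm_apply, id, Fin.ext_iff, Fin.val_rev]
    by_cases h3 : n - m + (r : ℕ) + (i + c) + 1 < n
    · rw [sMat_zero _ _ _ _ h3, map_zero, if_neg (by omega)]
    · rw [sMat_X K n _ _ (i + c + 1) (n - m + (r : ℕ) + (i + c) + 1 - n) (by omega) (by omega) rfl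
        (by simp only; omega)]
      have e : (φ : MvPolynomial (TIdx n) K →+* K) (MvPolynomial.X
          (tmk (i + c + 1) (n - m + (r : ℕ) + (i + c) + 1 - n) (by omega) (by omega))) =
          if n - m + (r : ℕ) + (i + c) + 1 - n = i then 1 else 0 :=
        MvPolynomial.aeval_X _ _
      rw [e]
      congr 1
      apply propext
      omega
  rw [h2, Matrix.det_permute] at h1
  rcases Int.units_eq_one_or (Equiv.Perm.sign (Fin.revPerm : Equiv.Perm (Fin m))) with h | h <;>
    rw [h] at h1 <;> simp at h1

end JGen

/-- The rational function field `K(s)` is generated over `K`, as a field, by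
the family `{π(J_{k,i}) : (k,i) ∈ T}`: the smallest subfield of `K(s)`
containing `K` and all `π(J_{k,i})` is `K(s)` itself. -/
theorem piHom_Jki_generate {n : ℕ} {K : Type*} [Field K] [CharZero K]
    (hn : 1 ≤ n) :
    Subfield.closure
        (Set.range (algebraMap K (FractionRing (MvPolynomial (TIdx n) K))) ∪
          {g | ∃ t : TIdx n,
            g = algebraMap (MvPolynomial (TIdx n) K) _
              (piHom K n (Jki t.1.1 t.1.2 t.2.1 t.2.2 (genMatrix K n)))}) =
      ⊤ := by
  set F := Subfield.closure
        (Set.range (algebraMap K (FractionRing (MvPolynomial (TIdx n) K))) ∪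
          {g | ∃ t : TIdx n,
            g = algebraMap (MvPolynomial (TIdx n) K) _
              (piHom K n (Jki t.1.1 t.1.2 t.2.1 t.2.2 (genMatrix K n)))}) with hF
  let ι : MvPolynomial (TIdx n) K →+* FractionRing (MvPolynomial (TIdx n) K) := algebraMap _ _
  have hι : Function.Injective ι := IsFractionRing.injective _ _
  have hent := JGen.main_field F ((JGen.sMat K n).map ι)
    (by
      intro a b hab
      rw [Matrix.map_apply, JGen.sMat_zero _ _ _ _ hab, map_zero])
    (by
      intro m i hmi
      rw [← JGen.mnr_map]
      exact (map_ne_zero_iff ι hι).2 (JGen.mnr_ne K n m i hmi))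
    (by
      intro k i hk hi
      rw [← JGen.Jki_map]
      refine Subfield.subset_closure (Or.inr ⟨⟨(k, i), hk, hi⟩, ?_⟩)
      have := JGen.Jki_map (piHom K n : MvPolynomial (Fin n × Fin n) K →+* MvPolynomial (TIdx n) K) k i hk hi
        (genMatrix K n)
      exact congrArg ι this.symm)
  have hX : ∀ t : TIdx n, ι (MvPolynomial.X t) ∈ F := by
    rintro ⟨⟨k, i⟩, hk, hi⟩
    simp only at hk hi
    have h := hent ⟨n - k + i, by omega⟩ ⟨k - 1, by omega⟩
    rw [Matrix.map_apply, JGen.sMat_X K n _ _ k i hk hi (by simp only; omega)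
      (by simp only; omega)] at h
    exact h
  have hP : ∀ p, ι p ∈ F := by
    intro p
    induction p using MvPolynomial.induction_on with
    | C a =>
      refine Subfield.subset_closure (Or.inl ⟨a, ?_⟩)
      rw [IsScalarTower.algebraMap_apply K (MvPolynomial (TIdx n) K)]
      rfl
    | add p q hp hq => rw [map_add]; exact F.add_mem hp hq
    | mul_X p t hp => rw [map_mul]; exact F.mul_mem hp (hX t)
  rw [eq_top_iff]
  intro x _
  obtain ⟨p, q, _, rfl⟩ := IsFractionRing.div_surjective (A := MvPolynomial (TIdx n) K) x
  exact F.div_mem (hP p) (hP q)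
end
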